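/- arXiv:1802.04077 — 4 statements merged into one kernel-verified Lean document; each statement's English description precedes it below -/
import Mathlib

section
/- Let α be a real number with α ∉ ℤ. If the infinite matrix A = (a_{nk}) maps c(Δ^(α)) into ℓ₁, then, setting ‖A‖ = sup over finite subsets N ⊂ ℕ of ( ∑_{k=0}^∞ |∑_{n∈N} â_{nk}| + |∑_{n∈N} γ_n| ), where â_{nk} = ∑_{j=k}^∞ (−1)^{j−k} Γ(−α+1)/((j−k)!·Γ(−α−j+k+1)) a_{nj} and γ_n = lim_{m→∞} ∑_{k=0}^{m} w^{(A_n)}_{mk} with w^{(A_n)}_{mk} = ∑_{j=m}^∞ (−1)^{j−k} Γ(−α+1)/((j−k)!·Γ(−α−j+k+1)) a_{nj} for 0 ≤ k ≤ m, the operator norm of L_A : c(Δ^(α)) → ℓ₁ satisfies ‖A‖ ≤ ‖L_A‖ ≤ 4‖A‖. -/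
open Filter Finset Topology

/-- The fractional difference matrix `Δ^(α)`. -/
noncomputable def fracDelta (α : ℝ) (n k : ℕ) : ℝ :=
  if k ≤ n then
    (-1 : ℝ) ^ (n - k) * Real.Gamma (α + 1) /
      ((Nat.factorial (n - k) : ℝ) * Real.Gamma (α - n + k + 1))
  else 0

/-- `(Δ^(α)x)_n = ∑_{k=0}^n Δ^(α)_{nk} x_k`. -/
noncomputable def fracDeltaSeq (α : ℝ) (x : ℕ → ℝ) (n : ℕ) : ℝ :=
  ∑ k ∈ Finset.range (n + 1), fracDelta α n k * x k

/-- Membership in `c(Δ^(α))`. -/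
def memCDelta (α : ℝ) (x : ℕ → ℝ) : Prop :=
  ∃ L : ℝ, Tendsto (fracDeltaSeq α x) atTop (nhds L)

/-- The norm `‖x‖ = sup_n |(Δ^(α)x)_n|`. -/
noncomputable def deltaNorm (α : ℝ) (x : ℕ → ℝ) : ℝ :=
  ⨆ n, |fracDeltaSeq α x n|

/-- Classical convergence of the series `∑_{j=0}^∞ f j` to `L`. -/
def SeriesHasSum (f : ℕ → ℝ) (L : ℝ) : Prop :=
  Tendsto (fun m => ∑ j ∈ Finset.range m, f j) atTop (nhds L)

/-- `(Ax)_n = ∑_k a_{nk} x_k` (the limit of the partial sums, when it exists). -/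
noncomputable def matMul (a : ℕ → ℕ → ℝ) (x : ℕ → ℝ) (n : ℕ) : ℝ :=
  limUnder atTop (fun m => ∑ k ∈ Finset.range m, a n k * x k)

theorem fd_choose_mul_factorial (α : ℝ) (hα : ∀ m : ℤ, α ≠ (m : ℝ)) (i : ℕ) :
    (descPochhammer ℤ i).smeval α * Real.Gamma (α - i + 1) = Real.Gamma (α + 1) := by
  induction i with
  | zero => simp
  | succ i ih =>
    have hne : α - i ≠ 0 := by
      intro h
      exact hα i (by push_cast; linarith)
    rw [Real.Gamma_add_one hne] at ih
    rw [descPochhammer_succ_right, Polynomial.smeval_mul, ← ih]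
    have : α - ((i + 1 : ℕ) : ℝ) + 1 = α - i := by push_cast; ring
    rw [this]
    simp [Polynomial.smeval_sub, Polynomial.smeval_natCast]
    ring

theorem fd_eq_choose (α : ℝ) (hα : ∀ m : ℤ, α ≠ (m : ℝ)) (k i : ℕ) :
    fracDelta α (k + i) k = (-1 : ℝ) ^ i * Ring.choose α i := by
  have hne : Real.Gamma (α - i + 1) ≠ 0 := by
    apply Real.Gamma_ne_zero
    intro m h
    exact hα ((i : ℤ) - 1 - m) (by push_cast; linarith)
  have h := fd_choose_mul_factorial α hα i
  have h2 : α - ((k + i : ℕ) : ℝ) + k + 1 = α - i + 1 := by push_cast; ring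
  have hf : (i.factorial : ℝ) ≠ 0 := by positivity
  rw [fracDelta, if_pos (by omega), Nat.add_sub_cancel_left, h2, Ring.choose_eq_smul, ← h, smul_eq_mul]
  field_simp

noncomputable def fdSer (α : ℝ) : PowerSeries ℝ :=
  PowerSeries.mk fun i => (-1 : ℝ) ^ i * Ring.choose α i

theorem fdSer_mul (α : ℝ) : fdSer α * fdSer (-α) = 1 := by
  ext n
  rw [PowerSeries.coeff_mul, PowerSeries.coeff_one, ← Ring.choose_zero_ite,
    show (0 : ℝ) = α + -α by ring, Ring.add_choose_eq n (Commute.all _ _)]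
  by_cases hn : n = 0
  · subst hn; simp [fdSer]
  have h0 : ∑ ij ∈ antidiagonal n, Ring.choose α ij.1 * Ring.choose (-α) ij.2 = 0 := by
    rw [← Ring.add_choose_eq n (Commute.all _ _), add_neg_cancel, Ring.choose_zero_ite, if_neg hn]
  rw [h0]
  have : ∑ p ∈ antidiagonal n, (PowerSeries.coeff p.1) (fdSer α) * (PowerSeries.coeff p.2) (fdSer (-α))
      = (-1) ^ n * ∑ ij ∈ antidiagonal n, Ring.choose α ij.1 * Ring.choose (-α) ij.2 := by
    rw [Finset.mul_sum]
    refine Finset.sum_congr rfl fun p hp => ?_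
    rw [← mem_antidiagonal.1 hp, pow_add]
    simp [fdSer]
    ring
  rw [this, h0, mul_zero]

theorem fdSeq_eq_coeff (α : ℝ) (hα : ∀ m : ℤ, α ≠ (m : ℝ)) (x : ℕ → ℝ) (n : ℕ) :
    fracDeltaSeq α x n = PowerSeries.coeff n (PowerSeries.mk x * fdSer α) := by
  rw [PowerSeries.coeff_mul, fracDeltaSeq,
    Finset.Nat.sum_antidiagonal_eq_sum_range_succ_mk]
  refine Finset.sum_congr rfl fun k hk => ?_
  have hk' : k ≤ n := by simpa [Nat.lt_succ_iff] using hk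
  obtain ⟨i, rfl⟩ := Nat.exists_eq_add_of_le hk'
  rw [fd_eq_choose α hα]
  simp [fdSer]
  ring

theorem fdSeq_inv (α : ℝ) (hα : ∀ m : ℤ, α ≠ (m : ℝ)) (x : ℕ → ℝ) :
    fracDeltaSeq α (fracDeltaSeq (-α) x) = x := by
  have hα' : ∀ m : ℤ, -α ≠ (m : ℝ) := fun m h => hα (-m) (by push_cast; linarith)
  have h : PowerSeries.mk (fracDeltaSeq (-α) x) = PowerSeries.mk x * fdSer (-α) := by
    ext n
    rw [PowerSeries.coeff_mk, fdSeq_eq_coeff (-α) hα']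
  ext n
  rw [fdSeq_eq_coeff α hα, h, mul_assoc, mul_comm (fdSer (-α)), fdSer_mul, mul_one,
    PowerSeries.coeff_mk]


theorem exists_cmap (u : ℕ → ℝ) (L : ℝ) (h : Tendsto u atTop (𝓝 L)) :
    ∃ y : C(OnePoint ℕ, ℝ), (∀ k : ℕ, y k = u k) ∧ y OnePoint.infty = L :=
  ⟨OnePoint.continuousMapMkNat u L h, fun _ => rfl, rfl⟩

theorem cmap_tendsto (y : C(OnePoint ℕ, ℝ)) :
    Tendsto (fun k : ℕ => y k) atTop (𝓝 (y OnePoint.infty)) :=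
  (OnePoint.continuous_iff_from_nat y).1 y.continuous

noncomputable def dlt (k : ℕ) : C(OnePoint ℕ, ℝ) :=
  OnePoint.continuousMapMkNat (fun j => if j = k then 1 else 0) 0 (by
    refine tendsto_const_nhds.congr' ?_
    filter_upwards [eventually_gt_atTop k] with j hj
    rw [if_neg (by omega)])

theorem dlt_coe (k j : ℕ) : dlt k (j : OnePoint ℕ) = if j = k then 1 else 0 := rfl
theorem dlt_inf (k : ℕ) : dlt k OnePoint.infty = 0 := rfl

noncomputable def stp (u : ℕ → ℝ) (t : ℝ) (K : ℕ) : C(OnePoint ℕ, ℝ) :=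
  ∑ k ∈ Finset.range K, (u k - t) • dlt k + t • (1 : C(OnePoint ℕ, ℝ))

theorem stp_coe (u : ℕ → ℝ) (t : ℝ) (K j : ℕ) :
    stp u t K (j : OnePoint ℕ) = if j < K then u j else t := by
  simp only [stp, ContinuousMap.add_apply, ContinuousMap.sum_apply, ContinuousMap.smul_apply,
    dlt_coe, ContinuousMap.one_apply, smul_eq_mul]
  simp only [mul_ite, mul_one, mul_zero, Finset.sum_ite_eq, Finset.mem_range]
  split_ifs <;> ring

theorem stp_inf (u : ℕ → ℝ) (t : ℝ) (K : ℕ) : stp u t K OnePoint.infty = t := by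
  simp [stp, ContinuousMap.sum_apply, dlt_inf]

theorem stp_norm (u : ℕ → ℝ) (t : ℝ) (K : ℕ) (hu : ∀ k, |u k| ≤ 1) (ht : |t| ≤ 1) :
    ‖stp u t K‖ ≤ 1 := by
  rw [ContinuousMap.norm_le _ zero_le_one]
  intro x
  induction x using OnePoint.rec with
  | infty => rw [stp_inf]; exact ht
  | coe j =>
    rw [stp_coe]
    split_ifs
    · exact hu j
    · exact ht

theorem stp_map (f : C(OnePoint ℕ, ℝ) →L[ℝ] ℝ) (u : ℕ → ℝ) (t : ℝ) (K : ℕ) :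
    f (stp u t K) = ∑ k ∈ Finset.range K, u k * f (dlt k)
      + t * (f 1 - ∑ k ∈ Finset.range K, f (dlt k)) := by
  simp only [stp, map_add, map_sum, map_smul, smul_eq_mul, sub_mul, Finset.sum_sub_distrib,
    ← Finset.mul_sum]
  ring


theorem abs_sgn_le' (x : ℝ) : |((SignType.sign x : SignType) : ℝ)| ≤ 1 := by
  rcases lt_trichotomy x 0 with h | h | h <;> simp [h]

theorem fun_summable (f : C(OnePoint ℕ, ℝ) →L[ℝ] ℝ) : Summable fun k => |f (dlt k)| := by
  refine summable_of_sum_range_le (c := ‖f‖) (fun _ => abs_nonneg _) fun K => ?_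
  have h := f.le_opNorm (stp (fun k => (SignType.sign (f (dlt k)) : ℝ)) 0 K)
  have h1 := stp_norm (fun k => (SignType.sign (f (dlt k)) : ℝ)) 0 K
    (fun k => abs_sgn_le' _) (by simp)
  rw [stp_map] at h
  simp only [sign_mul_self, zero_mul, add_zero] at h
  calc _ ≤ _ := le_abs_self _
    _ ≤ _ := h
    _ ≤ _ := mul_le_of_le_one_right (norm_nonneg _) h1

/-- lower bound -/
theorem fun_lower (f : C(OnePoint ℕ, ℝ) →L[ℝ] ℝ) (M : ℝ)
    (hM : ∀ y : C(OnePoint ℕ, ℝ), ‖y‖ ≤ 1 → f y ≤ M) :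
    (∑' k, |f (dlt k)|) + |f 1 - ∑' k, f (dlt k)| ≤ M := by
  have hs := fun_summable f
  have hs' : Summable fun k => f (dlt k) := hs.of_abs
  set c := f 1 - ∑' k, f (dlt k)
  have ht : Tendsto (fun K => f (stp (fun k => (SignType.sign (f (dlt k)) : ℝ))
      (SignType.sign c : ℝ) K)) atTop (𝓝 ((∑' k, |f (dlt k)|) + (SignType.sign c : ℝ) * c)) := by
    have e : ∀ x : ℝ, (SignType.sign x : ℝ) * x = |x| := sign_mul_self
    simp only [stp_map, fun k => e (f (dlt k))]
    exact hs.hasSum.tendsto_sum_nat.add ((hs'.hasSum.tendsto_sum_nat.const_sub _).const_mul _)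
  rw [sign_mul_self] at ht
  exact le_of_tendsto' ht fun K => hM _ (stp_norm _ _ _ (fun k => abs_sgn_le' _) (abs_sgn_le' _))

theorem fun_upper (f : C(OnePoint ℕ, ℝ) →L[ℝ] ℝ) (y : C(OnePoint ℕ, ℝ)) (hy : ‖y‖ ≤ 1) :
    |f y| ≤ (∑' k, |f (dlt k)|) + |f 1 - ∑' k, f (dlt k)| := by
  have hs := fun_summable f
  have hs' : Summable fun k => f (dlt k) := hs.of_abs
  have hb : ∀ x, |y x| ≤ 1 := fun x => (y.norm_coe_le_norm x).trans hy
  have hlim : Tendsto (fun K => stp (fun k => y k) (y OnePoint.infty) K) atTop (𝓝 y) := by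
    rw [Metric.tendsto_atTop]
    intro ε hε
    obtain ⟨K, hK⟩ := Metric.tendsto_atTop.1 (cmap_tendsto y) (ε / 2) (by positivity)
    refine ⟨K, fun m hm => lt_of_le_of_lt ?_ (half_lt_self hε)⟩
    rw [dist_eq_norm, ContinuousMap.norm_le _ (by positivity)]
    intro x
    induction x using OnePoint.rec with
    | infty => rw [ContinuousMap.sub_apply, stp_inf]; simp; positivity
    | coe j =>
      rw [ContinuousMap.sub_apply, stp_coe]
      split_ifs with hj
      · simp; positivity
      · rw [← dist_eq_norm, dist_comm]
        exact (hK j (by omega)).le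
  have h1 : Tendsto (fun K => |f (stp (fun k => y k) (y OnePoint.infty) K)|) atTop (𝓝 |f y|) :=
    ((f.continuous.tendsto y).comp hlim).abs
  have h2 : Tendsto (fun K => (∑ k ∈ Finset.range K, |f (dlt k)|)
      + |f 1 - ∑ k ∈ Finset.range K, f (dlt k)|) atTop
      (𝓝 ((∑' k, |f (dlt k)|) + |f 1 - ∑' k, f (dlt k)|)) :=
    hs.hasSum.tendsto_sum_nat.add (hs'.hasSum.tendsto_sum_nat.const_sub _).abs
  refine le_of_tendsto_of_tendsto' h1 h2 fun K => ?_
  rw [stp_map]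
  refine (abs_add_le _ _).trans (add_le_add ((Finset.abs_sum_le_sum_abs _ _).trans
    (Finset.sum_le_sum fun k _ => ?_)) ?_)
  · rw [abs_mul]; exact mul_le_of_le_one_left (abs_nonneg _) (hb _)
  · rw [abs_mul]; exact mul_le_of_le_one_left (abs_nonneg _) (hb _)

theorem sum_abs_le_two (M : ℝ) (g : ℕ → ℝ) (h : ∀ N : Finset ℕ, |∑ n ∈ N, g n| ≤ M)
    (N : Finset ℕ) : ∑ n ∈ N, |g n| ≤ 2 * M := by
  rw [← Finset.sum_filter_add_sum_filter_not N (fun n => 0 ≤ g n)]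
  have h1 := (abs_le.1 (h (N.filter fun n => 0 ≤ g n))).2
  have h2 := (abs_le.1 (h (N.filter fun n => ¬ 0 ≤ g n))).1
  have e1 : ∑ n ∈ N with 0 ≤ g n, |g n| = ∑ n ∈ N with 0 ≤ g n, g n :=
    Finset.sum_congr rfl fun n hn => abs_of_nonneg (Finset.mem_filter.1 hn).2
  have e2 : ∑ n ∈ N with ¬ 0 ≤ g n, |g n| = - ∑ n ∈ N with ¬ 0 ≤ g n, g n := by
    rw [← Finset.sum_neg_distrib]
    exact Finset.sum_congr rfl fun n hn => abs_of_neg (not_le.1 (Finset.mem_filter.1 hn).2)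
  linarith

theorem core (f : ℕ → C(OnePoint ℕ, ℝ) →L[ℝ] ℝ) (hf : ∀ y, Summable fun n => |f n y|)
    (b : ℕ → ℕ → ℝ) (γ : ℕ → ℝ) (hb : ∀ n k, f n (dlt k) = b n k)
    (hγ : ∀ n, f n 1 = ∑' k, b n k - γ n) :
    sSup {t : ℝ | ∃ N : Finset ℕ, t = (∑' k, |∑ n ∈ N, b n k|) + |∑ n ∈ N, γ n|} ≤
      sSup {t : ℝ | ∃ y : C(OnePoint ℕ, ℝ), ‖y‖ ≤ 1 ∧ t = ∑' n, |f n y|} ∧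
    sSup {t : ℝ | ∃ y : C(OnePoint ℕ, ℝ), ‖y‖ ≤ 1 ∧ t = ∑' n, |f n y|} ≤
      4 * sSup {t : ℝ | ∃ N : Finset ℕ, t = (∑' k, |∑ n ∈ N, b n k|) + |∑ n ∈ N, γ n|} := by
  have hsb : ∀ n, Summable fun k => b n k := fun n => by
    simpa [hb] using (fun_summable (f n)).of_abs
  -- values for the partial-sum functionals
  have hF : ∀ (N : Finset ℕ), (∑' k, |(∑ n ∈ N, f n) (dlt k)|)
      + |(∑ n ∈ N, f n) 1 - ∑' k, (∑ n ∈ N, f n) (dlt k)| =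
      (∑' k, |∑ n ∈ N, b n k|) + |∑ n ∈ N, γ n| := by
    intro N
    simp only [_root_.sum_apply, hb, hγ]
    rw [Summable.tsum_finsetSum fun n _ => hsb n, Finset.sum_sub_distrib, sub_sub_cancel_left,
      abs_neg]
  have hle : ∀ (N : Finset ℕ) y, |(∑ n ∈ N, f n) y| ≤ ∑' n, |f n y| := fun N y => by
    rw [_root_.sum_apply]
    exact (Finset.abs_sum_le_sum_abs _ _).trans
      ((hf y).sum_le_tsum N fun _ _ => abs_nonneg _)
  obtain ⟨C, hC⟩ := banach_steinhaus (g := fun N : Finset ℕ => ∑ n ∈ N, f n)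
    fun y => ⟨_, fun N => hle N y⟩
  have hB2 : BddAbove {t : ℝ | ∃ y : C(OnePoint ℕ, ℝ), ‖y‖ ≤ 1 ∧ t = ∑' n, |f n y|} := by
    refine ⟨2 * C, ?_⟩
    rintro _ ⟨y, hy, rfl⟩
    refine (hf y).tsum_le_of_sum_le fun N => sum_abs_le_two C _ (fun N' => ?_) N
    have h := (∑ n ∈ N', f n).le_opNorm y
    rw [_root_.sum_apply] at h
    exact h.trans ((mul_le_of_le_one_right (norm_nonneg _) hy).trans (hC N'))
  have h12 : ∀ N : Finset ℕ, (∑' k, |∑ n ∈ N, b n k|) + |∑ n ∈ N, γ n| ≤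
      sSup {t : ℝ | ∃ y : C(OnePoint ℕ, ℝ), ‖y‖ ≤ 1 ∧ t = ∑' n, |f n y|} := fun N => by
    rw [← hF]
    exact fun_lower _ _ fun y hy => (le_abs_self _).trans ((hle N y).trans
      (le_csSup hB2 ⟨y, hy, rfl⟩))
  have hB1 : BddAbove {t : ℝ | ∃ N : Finset ℕ, t = (∑' k, |∑ n ∈ N, b n k|) + |∑ n ∈ N, γ n|} := by
    refine ⟨sSup {t : ℝ | ∃ y : C(OnePoint ℕ, ℝ), ‖y‖ ≤ 1 ∧ t = ∑' n, |f n y|}, ?_⟩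
    rintro _ ⟨N, rfl⟩
    exact h12 N
  refine ⟨csSup_le ⟨_, ∅, rfl⟩ ?_, csSup_le ⟨_, 0, by simp, rfl⟩ ?_⟩
  · rintro _ ⟨N, rfl⟩
    exact h12 N
  · rintro _ ⟨y, hy, rfl⟩
    have h0 : 0 ≤ sSup {t : ℝ | ∃ N : Finset ℕ,
        t = (∑' k, |∑ n ∈ N, b n k|) + |∑ n ∈ N, γ n|} :=
      le_csSup hB1 ⟨∅, by simp⟩
    refine (hf y).tsum_le_of_sum_le fun N => (sum_abs_le_two _ _ (fun N' => ?_) N).trans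
      (mul_le_mul_of_nonneg_right (by norm_num) h0)
    have h := fun_upper (∑ n ∈ N', f n) y hy
    rw [hF, _root_.sum_apply] at h
    exact h.trans (le_csSup hB1 ⟨N', rfl⟩)


theorem fd_zero_of_lt (α : ℝ) {j k : ℕ} (h : j < k) : fracDelta α j k = 0 := by
  rw [fracDelta, if_neg (by omega)]

/-- If `A ∈ (c(Δ^(α)), ℓ₁)`, then `‖A‖ ≤ ‖L_A‖ ≤ 4‖A‖`, where
`‖A‖ = sup_{N ⊂ ℕ finite} ( ∑_k |∑_{n∈N} â_{nk}| + |∑_{n∈N} γ_n| )`. -/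
theorem operatorNorm_cDelta_into_l1 (α : ℝ) (hα : ∀ m : ℤ, α ≠ (m : ℝ))
    (a : ℕ → ℕ → ℝ)
    (hrows : ∀ x : ℕ → ℝ, memCDelta α x → ∀ n : ℕ, ∃ L : ℝ, SeriesHasSum (fun k => a n k * x k) L)
    (hmaps : ∀ x : ℕ → ℝ, memCDelta α x → Summable (fun n => |matMul a x n|))
    (Ahat : ℕ → ℕ → ℝ)
    (hAhat : ∀ n k, SeriesHasSum (fun j => fracDelta (-α) (k + j) k * a n (k + j)) (Ahat n k))
    (W : ℕ → ℕ → ℕ → ℝ)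
    (hW : ∀ n m k, k ≤ m →
      SeriesHasSum (fun j => fracDelta (-α) (m + j) k * a n (m + j)) (W n m k))
    (γ : ℕ → ℝ)
    (hγ : ∀ n, Tendsto (fun m => ∑ k ∈ Finset.range (m + 1), W n m k) atTop (nhds (γ n))) :
    sSup {t : ℝ | ∃ N : Finset ℕ, t = (∑' k, |∑ n ∈ N, Ahat n k|) + |∑ n ∈ N, γ n|} ≤
      sSup {t : ℝ | ∃ x : ℕ → ℝ, memCDelta α x ∧ deltaNorm α x ≤ 1 ∧
        t = ∑' n, |matMul a x n|} ∧
    sSup {t : ℝ | ∃ x : ℕ → ℝ, memCDelta α x ∧ deltaNorm α x ≤ 1 ∧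
        t = ∑' n, |matMul a x n|} ≤
      4 * sSup {t : ℝ | ∃ N : Finset ℕ, t = (∑' k, |∑ n ∈ N, Ahat n k|) + |∑ n ∈ N, γ n|} := by
  have hα' : ∀ m : ℤ, -α ≠ (m : ℝ) := fun m h => hα (-m) (by push_cast; linarith)
  have inv1 := fdSeq_inv α hα
  have inv2 : ∀ x, fracDeltaSeq (-α) (fracDeltaSeq α x) = x := by
    have := fdSeq_inv (-α) hα'
    rwa [neg_neg] at this
  have hmem : ∀ y : C(OnePoint ℕ, ℝ), memCDelta α (fracDeltaSeq (-α) fun k => y k) := fun y =>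
    ⟨y OnePoint.infty, by rw [inv1]; exact cmap_tendsto y⟩
  -- matrix products are limits
  have hmm : ∀ x, memCDelta α x → ∀ n,
      Tendsto (fun m => ∑ k ∈ Finset.range m, a n k * x k) atTop (𝓝 (matMul a x n)) := by
    intro x hx n
    exact tendsto_nhds_limUnder (hrows x hx n)
  let g : ℕ → ℕ → C(OnePoint ℕ, ℝ) →L[ℝ] ℝ := fun n m =>
    ∑ j ∈ Finset.range m, a n j • ∑ k ∈ Finset.range (j + 1),
      fracDelta (-α) j k • ContinuousMap.evalCLM ℝ (k : OnePoint ℕ)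
  have hg : ∀ n m y, g n m y =
      ∑ j ∈ Finset.range m, a n j * fracDeltaSeq (-α) (fun k => y k) j := by
    intro n m y
    simp [g, fracDeltaSeq]
  have hglim : ∀ n, Tendsto (fun m (y : C(OnePoint ℕ, ℝ)) => g n m y) atTop
      (𝓝 fun y => matMul a (fracDeltaSeq (-α) fun k => y k) n) := by
    intro n
    rw [tendsto_pi_nhds]
    intro y
    simp only [hg]
    exact hmm _ (hmem y) n
  let f : ℕ → C(OnePoint ℕ, ℝ) →L[ℝ] ℝ := fun n => continuousLinearMapOfTendsto (g n) (hglim n)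
  have hf : ∀ n y, f n y = matMul a (fracDeltaSeq (-α) fun k => y k) n := fun n y => rfl
  have hft : ∀ n y, Tendsto (fun m => g n m y) atTop (𝓝 (f n y)) := fun n y =>
    (tendsto_pi_nhds.1 (hglim n)) y
  -- finite columns
  have hcol : ∀ n k, Tendsto (fun m => ∑ j ∈ Finset.range m, a n j * fracDelta (-α) j k) atTop
      (𝓝 (Ahat n k)) := by
    intro n k
    rw [← tendsto_add_atTop_iff_nat k]
    refine (hAhat n k).congr fun m => ?_
    rw [add_comm m k, Finset.sum_range_add, Finset.sum_eq_zero (s := Finset.range k), zero_add]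
    · exact Finset.sum_congr rfl fun j _ => mul_comm _ _
    · intro j hj
      rw [fd_zero_of_lt _ (Finset.mem_range.1 hj), mul_zero]
  have hAW : ∀ n m k, k ≤ m →
      ∑ j ∈ Finset.range m, a n j * fracDelta (-α) j k = Ahat n k - W n m k := by
    intro n m k hk
    have h1 := ((tendsto_add_atTop_iff_nat m).2 (hcol n k))
    have h2 : Tendsto (fun i => ∑ j ∈ Finset.range (i + m), a n j * fracDelta (-α) j k) atTop
        (𝓝 ((∑ j ∈ Finset.range m, a n j * fracDelta (-α) j k) + W n m k)) := by
      refine ((hW n m k hk).const_add _).congr fun i => ?_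
      rw [add_comm i m, Finset.sum_range_add]
      congr 1
      exact Finset.sum_congr rfl fun j _ => mul_comm _ _
    linarith [tendsto_nhds_unique h1 h2]
  have hb : ∀ n k, f n (dlt k) = Ahat n k := by
    intro n k
    refine tendsto_nhds_unique (hft n (dlt k)) ((hcol n k).congr fun m => ?_)
    rw [hg]
    refine Finset.sum_congr rfl fun j _ => ?_
    congr 1
    simp only [fracDeltaSeq, dlt_coe, mul_ite, mul_one, mul_zero, Finset.sum_ite_eq',
      Finset.mem_range]
    split_ifs with h
    · rfl
    · exact fd_zero_of_lt _ (by omega)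
  have hsb : ∀ n, Summable fun k => Ahat n k := fun n => by
    simpa [hb] using (fun_summable (f n)).of_abs
  have h1 : ∀ n, f n 1 = ∑' k, Ahat n k - γ n := by
    intro n
    refine tendsto_nhds_unique (hft n 1) ?_
    have hs := (hsb n).hasSum.tendsto_sum_nat
    have h0 := (hsb n).tendsto_atTop_zero
    have := (hs.sub (hγ n)).add h0
    rw [add_zero] at this
    refine this.congr fun m => ?_
    have hmm' : W n m m = Ahat n m := by
      have := hAW n m m le_rfl
      rw [Finset.sum_eq_zero] at this
      · linarith
      · intro j hj
        rw [fd_zero_of_lt _ (Finset.mem_range.1 hj), mul_zero]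
    have e : g n m 1 = ∑ k ∈ Finset.range m, (Ahat n k - W n m k) := by
      rw [hg, ← Finset.sum_congr rfl fun k hk => hAW n m k (Finset.mem_range.1 hk).le,
        Finset.sum_comm]
      refine Finset.sum_congr rfl fun j hj => ?_
      rw [← Finset.mul_sum]
      congr 1
      simp only [fracDeltaSeq, ContinuousMap.one_apply, mul_one]
      refine Finset.sum_subset ?_ ?_
      · intro k hk
        simp only [Finset.mem_range] at *
        omega
      · intro k _ hk
        simp only [Finset.mem_range] at *
        exact fd_zero_of_lt _ (by omega)
    rw [e, Finset.sum_sub_distrib, Finset.sum_range_succ, hmm']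
    ring
  have hset : {t : ℝ | ∃ x : ℕ → ℝ, memCDelta α x ∧ deltaNorm α x ≤ 1 ∧
        t = ∑' n, |matMul a x n|} =
      {t : ℝ | ∃ y : C(OnePoint ℕ, ℝ), ‖y‖ ≤ 1 ∧ t = ∑' n, |f n y|} := by
    ext t
    constructor
    · rintro ⟨x, ⟨L, hL⟩, hx, rfl⟩
      obtain ⟨y, hy, hyL⟩ := exists_cmap _ _ hL
      have hbd : ∀ k, |fracDeltaSeq α x k| ≤ 1 := fun k =>
        (le_ciSup hL.abs.bddAbove_range k).trans hx
      refine ⟨y, ?_, ?_⟩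
      · rw [ContinuousMap.norm_le _ zero_le_one]
        intro z
        induction z using OnePoint.rec with
        | infty => rw [hyL]; exact le_of_tendsto' hL.abs hbd
        | coe j => rw [hy]; exact hbd j
      · simp only [hf, hy]
        rw [inv2]
    · rintro ⟨y, hy, rfl⟩
      refine ⟨_, hmem y, ?_, rfl⟩
      rw [deltaNorm, inv1]
      exact ciSup_le fun k => (y.norm_coe_le_norm k).trans hy
  rw [hset]
  exact core f (fun y => hmaps _ (hmem y)) Ahat γ hb h1
end

section
/- Let α be a real number with α ∉ ℤ and A = (a_{nk}) an infinite real matrix. Then A maps ℓ∞(Δ^(α)) into ℓ∞ (i.e., for every bounded-fractional-difference sequence x the series A_n x = ∑_k a_{nk} x_k converge and (A_n x)_n is bounded) if and only if the series defining â_{nk} and w^{(A_n)}_{mk} converge and the conditions sup_n ∑_{k=0}^∞ |â_{nk}| < ∞ and, for every n, lim_{m→∞} ∑_{k=0}^{m} |w^{(A_n)}_{mk}| = 0 hold, where â_{nk} = ∑_{j=k}^∞ (−1)^{j−k} Γ(−α+1)/((j−k)!·Γ(−α−j+k+1)) a_{nj} and w^{(A_n)}_{mk} = ∑_{j=m}^∞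 (−1)^{j−k} Γ(−α+1)/((j−k)!·Γ(−α−j+k+1)) a_{nj} for 0 ≤ k ≤ m. -/
open Filter Finset Topology

/-- Membership in `ℓ∞(Δ^(α))`. -/
def memLinfDelta (α : ℝ) (x : ℕ → ℝ) : Prop :=
  ∃ C : ℝ, ∀ n, |fracDeltaSeq α x n| ≤ C

theorem aux_coeff (β : ℝ) (hβ : ∀ m : ℤ, β ≠ (m : ℝ)) (i : ℕ) :
    (-1 : ℝ) ^ i * Real.Gamma (β + 1) / ((Nat.factorial i : ℝ) * Real.Gamma (β - i + 1)) =
      (-1 : ℝ) ^ i * Ring.choose β i := by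
  have hG : ∀ m : ℤ, Real.Gamma (β + m) ≠ 0 := by
    intro m
    apply Real.Gamma_ne_zero
    intro k hk
    apply hβ (-k - m)
    push_cast
    linarith
  induction i with
  | zero =>
    have := hG 1
    simp at this ⊢
    exact this
  | succ i ih =>
    have h1 := Ring.choose_smul_choose β (Nat.le_succ i)
    simp at h1
    have h2 : β - i ≠ 0 := by
      intro h
      apply hβ i
      push_cast
      linarith
    have h3 := Real.Gamma_add_one h2
    have h4 : Real.Gamma (β - i) ≠ 0 := by
      have := hG (-i)
      push_cast at this
      rwa [← sub_eq_add_neg] at this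
    have h5 : β - ((i + 1 : ℕ) : ℝ) + 1 = β - i := by push_cast; ring
    have hf : (Nat.factorial i : ℝ) ≠ 0 := by positivity
    have hi : (i : ℝ) + 1 ≠ 0 := by positivity
    rw [h5, Nat.factorial_succ]
    rw [h3] at ih
    have hs : (-1 : ℝ) ^ i ≠ 0 := by simp
    have ih' : Real.Gamma (β + 1) = Ring.choose β i * (Nat.factorial i * ((β - i) * Real.Gamma (β - i))) := by
      rw [mul_div_assoc] at ih
      have := mul_left_cancel₀ hs ih
      rw [← this]
      field_simp
    have h6 : Ring.choose β (i + 1) = Ring.choose β i * (β - i) / (i + 1) := by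
      rw [eq_div_iff hi, ← h1]; ring
    rw [ih', h6]
    push_cast
    field_simp

theorem aux_fracDelta (β : ℝ) (hβ : ∀ m : ℤ, β ≠ (m : ℝ)) (n k : ℕ) (h : k ≤ n) :
    fracDelta β n k = (-1 : ℝ) ^ (n - k) * Ring.choose β (n - k) := by
  rw [fracDelta, if_pos h, ← aux_coeff β hβ]
  congr 4
  push_cast [h]
  ring

theorem aux_seq (β : ℝ) (hβ : ∀ m : ℤ, β ≠ (m : ℝ)) (x : ℕ → ℝ) (n : ℕ) :
    fracDeltaSeq β x n = PowerSeries.coeff n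
      (PowerSeries.mk x * PowerSeries.rescale (-1) (PowerSeries.binomialSeries ℝ β)) := by
  rw [PowerSeries.coeff_mul, Finset.Nat.sum_antidiagonal_eq_sum_range_succ_mk, fracDeltaSeq]
  apply Finset.sum_congr rfl
  intro k hk
  rw [aux_fracDelta β hβ n k (by simp at hk; omega)]
  simp [PowerSeries.coeff_rescale]
  ring

theorem aux_inv (β : ℝ) (hβ : ∀ m : ℤ, β ≠ (m : ℝ)) (x : ℕ → ℝ) :
    fracDeltaSeq (-β) (fracDeltaSeq β x) = x := by
  have hβ' : ∀ m : ℤ, -β ≠ (m : ℝ) := by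
    intro m h
    apply hβ (-m)
    push_cast
    linarith
  funext n
  rw [aux_seq _ hβ']
  have : PowerSeries.mk (fracDeltaSeq β x) =
      PowerSeries.mk x * PowerSeries.rescale (-1) (PowerSeries.binomialSeries ℝ β) := by
    ext m
    rw [PowerSeries.coeff_mk, aux_seq β hβ]
  rw [this, mul_assoc, ← map_mul, ← PowerSeries.binomialSeries_add]
  simp

theorem aux_baire (F : ℕ → Set (ℕ → Set.Icc (-1 : ℝ) 1)) (hc : ∀ N, IsClosed (F N))
    (hU : ∀ z, ∃ N, z ∈ F N) :
    ∃ N K, ∃ z0 : ℕ → Set.Icc (-1 : ℝ) 1, ∀ z, (∀ k < K, z k = z0 k) → z ∈ F N := by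
  have : Nonempty (Set.Icc (-1 : ℝ) 1) := ⟨⟨0, by norm_num⟩⟩
  obtain ⟨N, z0, hz0⟩ := nonempty_interior_of_iUnion_of_closed hc (Set.eq_univ_of_forall (by simpa using hU))
  obtain ⟨I, u, h1, h2⟩ := isOpen_pi_iff.1 isOpen_interior z0 hz0
  refine ⟨N, I.sup id + 1, z0, fun z hz => interior_subset (h2 ?_)⟩
  intro i hi
  have : i ≤ I.sup id := Finset.le_sup (f := id) hi
  rw [hz i (by omega)]
  exact (h1 i hi).2

theorem aux_tail {ι : Type} (b : ι → ℕ → ℝ) (hb : ∀ i, Summable fun k => |b i k|)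
    (G : ℕ → Set ι) (ε : ℕ → ℝ)
    (h : ∀ z : ℕ → ℝ, (∀ k, |z k| ≤ 1) → ∃ N, ∀ i ∈ G N, |∑' k, b i k * z k| ≤ ε N) :
    ∃ N K, ∀ i ∈ G N, ∀ R, ∑ k ∈ Finset.Ico K R, |b i k| ≤ 2 * ε N := by
  have hz1 : ∀ t : Set.Icc (-1 : ℝ) 1, |(t : ℝ)| ≤ 1 := fun t => abs_le.2 t.2
  have hbound : ∀ i (k : ℕ) (t : Set.Icc (-1 : ℝ) 1), ‖b i k * (t : ℝ)‖ ≤ |b i k| := by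
    intro i k t
    rw [Real.norm_eq_abs, abs_mul]
    exact mul_le_of_le_one_right (abs_nonneg _) (hz1 t)
  obtain ⟨N, K, z0, hN⟩ := aux_baire
    (fun N => {z | ∀ i ∈ G N, |∑' k, b i k * (z k : ℝ)| ≤ ε N}) (by
      intro N
      simp only [Set.ofPred_forall]
      refine isClosed_iInter fun i => isClosed_iInter fun _ => ?_
      refine isClosed_le (continuous_abs.comp ?_) continuous_const
      exact continuous_tsum (fun k => by fun_prop) (hb i) (fun k z => hbound i k (z k)))
    (fun z => h (fun k => z k) (fun k => hz1 _))
  refine ⟨N, K, fun i hi R => ?_⟩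
  have hsg : ∀ t : ℝ, (SignType.sign t : ℝ) ∈ Set.Icc (-1 : ℝ) 1 := by
    intro t
    rcases lt_trichotomy t 0 with h | h | h <;> simp [h]
  let z1 : ℕ → Set.Icc (-1 : ℝ) 1 := fun k => if k < K then z0 k else ⟨0, by norm_num⟩
  let z2 : ℕ → Set.Icc (-1 : ℝ) 1 := fun k => if k < K then z0 k else
    if k < R then ⟨SignType.sign (b i k), hsg _⟩ else ⟨0, by norm_num⟩
  have e1 := hN z1 (fun k hk => by simp [z1, hk]) i hi
  have e2 := hN z2 (fun k hk => by simp [z2, hk]) i hi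
  have s : ∀ z : ℕ → Set.Icc (-1 : ℝ) 1, Summable fun k => b i k * (z k : ℝ) := fun z =>
    Summable.of_norm_bounded (hb i) (fun k => hbound i k (z k))
  have key : ∑ k ∈ Finset.Ico K R, |b i k| = (∑' k, b i k * (z2 k : ℝ)) - ∑' k, b i k * (z1 k : ℝ) := by
    rw [← (s z2).tsum_sub (s z1), tsum_eq_sum (s := Finset.Ico K R)]
    · apply Finset.sum_congr rfl
      intro k hk
      rw [Finset.mem_Ico] at hk
      simp [z1, z2, not_lt.2 hk.1, hk.2]
    · intro k hk
      rw [Finset.mem_Ico] at hk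
      by_cases h1 : k < K
      · simp [z1, z2, h1]
      · have : ¬ k < R := fun h => hk ⟨by omega, h⟩
        simp [z1, z2, h1, this]
  rw [key]
  have := abs_le.1 e1
  have := abs_le.1 e2
  linarith

theorem aux_single (C : ℝ) (f : ℕ → ℝ) (k : ℕ) (M : ℕ) (h : k < M) :
    ∑ j ∈ Finset.range M, f j * (if j = k then C else 0) = f k * C := by
  simp [h]

theorem aux_schur (T : ℕ → ℕ → ℝ) (hT : ∀ M k, M ≤ k → T M k = 0)
    (h : ∀ z : ℕ → ℝ, (∀ k, |z k| ≤ 1) →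
      ∃ y, Tendsto (fun M => ∑ k ∈ Finset.range M, T M k * z k) atTop (nhds y)) :
    ∃ A : ℕ → ℝ, (∀ k, Tendsto (fun M => T M k) atTop (nhds (A k))) ∧
      (Summable fun k => |A k|) ∧
      ∀ ε > 0, ∃ N, ∀ M ≥ N, ∀ R, ∑ k ∈ Finset.range R, |A k - T M k| ≤ ε := by
  have hA : ∀ k, ∃ y, Tendsto (fun M => T M k) atTop (nhds y) := by
    intro k
    obtain ⟨y, hy⟩ := h (fun j => if j = k then 1 else 0) (by intro j; split_ifs <;> simp)
    refine ⟨y, hy.congr' ?_⟩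
    filter_upwards [eventually_gt_atTop k] with M hM
    rw [aux_single _ _ _ _ hM, mul_one]
  choose A hA using hA
  have hts : ∀ (M R : ℕ) (z : ℕ → ℝ), M ≤ R → ∑ k ∈ Finset.range R, T M k * z k = ∑ k ∈ Finset.range M, T M k * z k := by
    intro M R z hMR
    symm
    apply Finset.sum_subset (Finset.range_mono hMR)
    intro k _ hk
    rw [hT M k (by simpa using hk), zero_mul]
  have hsum : ∀ M (z : ℕ → ℝ), Summable fun k => T M k * z k := fun M z =>
    summable_of_ne_finset_zero (s := Finset.range M) (fun k hk => by
      rw [hT M k (by simpa using hk), zero_mul])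
  have htsum : ∀ M (z : ℕ → ℝ), ∑' k, T M k * z k = ∑ k ∈ Finset.range M, T M k * z k := fun M z =>
    tsum_eq_sum (fun k hk => by
      rw [hT M k (by simpa using hk), zero_mul])
  have tail : ∀ ε > 0, ∃ N K, ∀ M ≥ N, ∀ R, ∑ k ∈ Finset.Ico K R, |A k - T M k| ≤ ε := by
    intro ε hε
    obtain ⟨N, K, hNK⟩ := aux_tail (fun (p : ℕ × ℕ) k => T p.1 k - T p.2 k)
      (fun p => by
        apply summable_of_ne_finset_zero (s := Finset.range (max p.1 p.2))
        intro k hk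
        simp at hk
        simp [hT p.1 k hk.1, hT p.2 k hk.2])
      (fun N => {p | N ≤ p.1 ∧ N ≤ p.2}) (fun _ => ε / 2) (by
        intro z hz
        obtain ⟨y, hy⟩ := h z hz
        obtain ⟨N, hN⟩ := Metric.cauchySeq_iff.1 hy.cauchySeq (ε / 2) (by positivity)
        refine ⟨N, fun p hp => ?_⟩
        have := hN p.1 hp.1 p.2 hp.2
        rw [Real.dist_eq, ← htsum, ← htsum, ← (hsum _ z).tsum_sub (hsum _ z)] at this
        simp only [sub_mul]
        exact this.le)
    refine ⟨N, K, fun M hM R => ?_⟩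
    have ht : Tendsto (fun M' => ∑ k ∈ Finset.Ico K R, |T M' k - T M k|) atTop
        (nhds (∑ k ∈ Finset.Ico K R, |A k - T M k|)) :=
      tendsto_finsetSum _ fun k _ => ((hA k).sub_const _).abs
    refine le_of_tendsto ht ?_
    filter_upwards [eventually_ge_atTop N] with M' hM'
    have := hNK (M', M) ⟨hM', hM⟩ R
    linarith
  have split : ∀ (f : ℕ → ℝ) (K R : ℕ), (∀ k, 0 ≤ f k) → ∑ k ∈ Finset.range R, f k ≤
      ∑ k ∈ Finset.range K, f k + ∑ k ∈ Finset.Ico K R, f k := by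
    intro f K R hf
    rcases le_total K R with hKR | hKR
    · rw [Finset.sum_range_add_sum_Ico _ hKR]
    · rw [Finset.Ico_eq_empty_of_le hKR]
      simp only [Finset.sum_empty, add_zero]
      exact Finset.sum_le_sum_of_subset_of_nonneg (Finset.range_mono hKR) (fun k _ _ => hf k)
  refine ⟨A, hA, ?_, ?_⟩
  · obtain ⟨N, K, hNK⟩ := tail 1 one_pos
    have s1 : Summable fun k => |A k - T N k| :=
      summable_of_sum_range_le (fun k => abs_nonneg _) (c := ∑ k ∈ Finset.range K, |A k - T N k| + 1)
        (fun R => (split _ K R (fun k => abs_nonneg _)).trans (by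
          have := hNK N le_rfl R
          linarith))
    have s2 : Summable fun k => T N k := by simpa using hsum N (fun _ => 1)
    have := s1.of_abs.add s2
    simpa using this.abs
  · intro ε hε
    obtain ⟨N, K, hNK⟩ := tail (ε / 2) (by positivity)
    have ht : Tendsto (fun M => ∑ k ∈ Finset.range K, |A k - T M k|) atTop (nhds 0) := by
      have : Tendsto (fun M => ∑ k ∈ Finset.range K, |A k - T M k|) atTop
          (nhds (∑ k ∈ Finset.range K, |A k - A k|)) :=
        tendsto_finsetSum _ fun k _ => ((hA k).const_sub _).abs
      simpa using this
    obtain ⟨N', hN'⟩ := eventually_atTop.1 (ht.eventually (ge_mem_nhds (show (0:ℝ) < ε / 2 by positivity)))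
    refine ⟨max N N', fun M hM R => ?_⟩
    have h1 := hNK M (le_trans (le_max_left _ _) hM) R
    have h2 := hN' M (le_trans (le_max_right _ _) hM)
    have h3 := split (fun k => |A k - T M k|) K R (fun k => abs_nonneg _)
    linarith

theorem aux_conv (T : ℕ → ℕ → ℝ) (A z : ℕ → ℝ) (C : ℝ) (hz : ∀ k, |z k| ≤ C)
    (hA : Summable fun k => |A k|)
    (hT : Tendsto (fun M => ∑ k ∈ Finset.range M, |A k - T M k|) atTop (nhds 0)) :
    (Summable fun k => |A k * z k|) ∧
    Tendsto (fun M => ∑ k ∈ Finset.range M, T M k * z k) atTop (nhds (∑' k, A k * z k)) := by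
  have hs : Summable fun k => |A k * z k| := by
    refine Summable.of_nonneg_of_le (fun k => abs_nonneg _) (fun k => ?_) (hA.mul_right C)
    rw [abs_mul]
    exact mul_le_mul_of_nonneg_left (hz k) (abs_nonneg _)
  refine ⟨hs, ?_⟩
  have h1 := hs.of_abs.hasSum.tendsto_sum_nat
  have h2 : Tendsto (fun M => ∑ k ∈ Finset.range M, (A k - T M k) * z k) atTop (nhds 0) := by
    refine squeeze_zero_norm (a := fun M => (∑ k ∈ Finset.range M, |A k - T M k|) * C) (fun M => ?_) (by simpa using hT.mul_const C)
    rw [Finset.sum_mul]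
    refine (norm_sum_le _ _).trans (Finset.sum_le_sum fun k _ => ?_)
    rw [Real.norm_eq_abs, abs_mul]
    exact mul_le_mul_of_nonneg_left (hz k) (abs_nonneg _)
  have h3 := h1.sub h2
  rw [sub_zero] at h3
  refine h3.congr fun M => ?_
  rw [← Finset.sum_sub_distrib]
  exact Finset.sum_congr rfl fun k _ => by ring

/-- Truncated transposed sums. -/
noncomputable def auxT (α : ℝ) (a : ℕ → ℝ) (M k : ℕ) : ℝ :=
  ∑ j ∈ Finset.range M, fracDelta (-α) j k * a j

theorem auxT_zero (α : ℝ) (a : ℕ → ℝ) (M k : ℕ) (h : M ≤ k) : auxT α a M k = 0 := by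
  apply Finset.sum_eq_zero
  intro j hj
  rw [Finset.mem_range] at hj
  rw [fracDelta, if_neg (by omega), zero_mul]

theorem auxT_shift (α : ℝ) (a : ℕ → ℝ) (m r k : ℕ) :
    ∑ j ∈ Finset.range r, fracDelta (-α) (m + j) k * a (m + j) = auxT α a (m + r) k - auxT α a m k := by
  rw [auxT, auxT, Finset.sum_range_add]
  ring

theorem auxT_sum (α : ℝ) (a z : ℕ → ℝ) (M : ℕ) :
    ∑ j ∈ Finset.range M, a j * fracDeltaSeq (-α) z j = ∑ k ∈ Finset.range M, auxT α a M k * z k := by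
  simp only [auxT, Finset.sum_mul]
  rw [Finset.sum_comm]
  apply Finset.sum_congr rfl
  intro j hj
  rw [Finset.mem_range] at hj
  rw [fracDeltaSeq, Finset.mul_sum]
  rw [Finset.sum_subset (Finset.range_mono (show j + 1 ≤ M by omega))]
  · exact Finset.sum_congr rfl fun k _ => by ring
  · intro k _ hk
    rw [Finset.mem_range] at hk
    rw [fracDelta, if_neg (by omega)]
    ring

/-- Characterization of `A ∈ (ℓ∞(Δ^(α)), ℓ∞)`: `A` maps `ℓ∞(Δ^(α))` into `ℓ∞` iff the
series defining `â_{nk}` and `w^{(A_n)}_{mk}` converge, `sup_n ∑_k |â_{nk}| < ∞` and,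
for every `n`, `lim_m ∑_{k=0}^m |w^{(A_n)}_{mk}| = 0`. -/
theorem matrix_linfDelta_into_linf (α : ℝ) (hα : ∀ m : ℤ, α ≠ (m : ℝ))
    (a : ℕ → ℕ → ℝ) :
    (∀ x : ℕ → ℝ, memLinfDelta α x →
      ∃ y : ℕ → ℝ, (∀ n, SeriesHasSum (fun k => a n k * x k) (y n)) ∧
        ∃ C : ℝ, ∀ n, |y n| ≤ C) ↔
    (∃ Ahat : ℕ → ℕ → ℝ,
      (∀ n k, SeriesHasSum (fun j => fracDelta (-α) (k + j) k * a n (k + j)) (Ahat n k)) ∧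
      (∃ C : ℝ, ∀ n m, ∑ k ∈ Finset.range m, |Ahat n k| ≤ C)) ∧
    (∃ W : ℕ → ℕ → ℕ → ℝ,
      (∀ n m k, k ≤ m →
        SeriesHasSum (fun j => fracDelta (-α) (m + j) k * a n (m + j)) (W n m k)) ∧
      (∀ n, Tendsto (fun m => ∑ k ∈ Finset.range (m + 1), |W n m k|) atTop (nhds 0))) := by
  have hα' : ∀ m : ℤ, -α ≠ (m : ℝ) := by
    intro m h
    apply hα (-m)
    push_cast
    linarith
  have inv1 : ∀ z, fracDeltaSeq α (fracDeltaSeq (-α) z) = z := by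
    intro z
    have := aux_inv (-α) hα' z
    rwa [neg_neg] at this
  have inv2 : ∀ x, fracDeltaSeq (-α) (fracDeltaSeq α x) = x := aux_inv α hα
  constructor
  · intro H
    have H' : ∀ z : ℕ → ℝ, (∀ k, |z k| ≤ 1) → ∃ y : ℕ → ℝ,
        (∀ n, Tendsto (fun M => ∑ k ∈ Finset.range M, auxT α (a n) M k * z k) atTop (nhds (y n))) ∧
        ∃ C : ℝ, ∀ n, |y n| ≤ C := by
      intro z hz
      obtain ⟨y, hy, hC⟩ := H (fracDeltaSeq (-α) z) ⟨1, fun n => by rw [inv1]; exact hz n⟩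
      refine ⟨y, fun n => ?_, hC⟩
      have := hy n
      unfold SeriesHasSum at this
      simpa only [auxT_sum] using this
    have S := fun n => aux_schur (auxT α (a n)) (auxT_zero α (a n)) (fun z hz => by
      obtain ⟨y, hy, _⟩ := H' z hz
      exact ⟨y n, hy n⟩)
    choose A hA hs herr using S
    have herr' : ∀ n, Tendsto (fun M => ∑ k ∈ Finset.range M, |A n k - auxT α (a n) M k|) atTop (nhds 0) := by
      intro n
      rw [Metric.tendsto_atTop]
      intro ε hε
      obtain ⟨N, hN⟩ := herr n (ε / 2) (by positivity)
      refine ⟨N, fun M hM => ?_⟩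
      rw [Real.dist_eq, sub_zero, abs_of_nonneg (Finset.sum_nonneg fun k _ => abs_nonneg _)]
      linarith [hN M hM M]
    have B : ∀ z : ℕ → ℝ, (∀ k, |z k| ≤ 1) → ∃ N : ℕ, ∀ n, |∑' k, A n k * z k| ≤ N := by
      intro z hz
      obtain ⟨y, hy, C, hC⟩ := H' z hz
      obtain ⟨N, hN⟩ := exists_nat_ge C
      refine ⟨N, fun n => ?_⟩
      rw [tendsto_nhds_unique (aux_conv _ _ z 1 hz (hs n) (herr' n)).2 (hy n)]
      exact (hC n).trans hN
    refine ⟨⟨A, fun n k => ?_, ?_⟩, ⟨fun n m k => A n k - auxT α (a n) m k, fun n m k _ => ?_, fun n => ?_⟩⟩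
    · unfold SeriesHasSum
      simp only [auxT_shift, auxT_zero α (a n) k k le_rfl, sub_zero]
      exact (hA n k).comp (tendsto_atTop_mono (fun r => Nat.le_add_left r k) tendsto_id)
    · obtain ⟨N, K, hNK⟩ := aux_tail A hs (fun _ => Set.univ) (fun N => (N : ℝ)) (fun z hz => by
        obtain ⟨N, hN⟩ := B z hz
        exact ⟨N, fun n _ => hN n⟩)
      have col : ∀ k, ∃ c : ℝ, ∀ n, |A n k| ≤ c := by
        intro k
        obtain ⟨N, hN⟩ := B (fun j => if j = k then 1 else 0) (by intro j; split_ifs <;> simp)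
        refine ⟨N, fun n => ?_⟩
        simpa using hN n
      choose c hc using col
      refine ⟨∑ k ∈ Finset.range K, c k + 2 * N, fun n m => ?_⟩
      calc ∑ k ∈ Finset.range m, |A n k| ≤ ∑ k ∈ Finset.range (K + m), |A n k| :=
            Finset.sum_le_sum_of_subset_of_nonneg (Finset.range_mono (by omega)) (fun k _ _ => abs_nonneg _)
        _ = ∑ k ∈ Finset.range K, |A n k| + ∑ k ∈ Finset.Ico K (K + m), |A n k| :=
            (Finset.sum_range_add_sum_Ico _ (by omega)).symm
        _ ≤ _ := add_le_add (Finset.sum_le_sum fun k _ => hc k n) (hNK n trivial _)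
    · unfold SeriesHasSum
      simp only [auxT_shift]
      exact ((hA n k).comp (tendsto_atTop_mono (fun r => Nat.le_add_left r m) tendsto_id)).sub_const _
    · rw [Metric.tendsto_atTop]
      intro ε hε
      obtain ⟨N, hN⟩ := herr n (ε / 2) (by positivity)
      refine ⟨N, fun M hM => ?_⟩
      rw [Real.dist_eq, sub_zero, abs_of_nonneg (Finset.sum_nonneg fun k _ => abs_nonneg _)]
      linarith [hN M hM (M + 1)]
  · rintro ⟨⟨A, hA, C, hC⟩, W, hW, hW0⟩ x ⟨D, hD⟩
    have hs : ∀ n, Summable fun k => |A n k| := fun n =>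
      summable_of_sum_range_le (fun k => abs_nonneg _) (hC n)
    have hAT : ∀ n k, Tendsto (fun M => auxT α (a n) M k) atTop (nhds (A n k)) := by
      intro n k
      have := hA n k
      unfold SeriesHasSum at this
      simp only [auxT_shift, auxT_zero α (a n) k k le_rfl, sub_zero] at this
      simp only [add_comm k] at this
      exact (tendsto_add_atTop_iff_nat k).1 this
    have hWT : ∀ n m k, k ≤ m → W n m k = A n k - auxT α (a n) m k := by
      intro n m k hk
      have := hW n m k hk
      unfold SeriesHasSum at this
      simp only [auxT_shift] at this
      exact tendsto_nhds_unique this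
        (((hAT n k).comp (tendsto_atTop_mono (fun r => Nat.le_add_left r m) tendsto_id)).sub_const _)
    have herr : ∀ n, Tendsto (fun M => ∑ k ∈ Finset.range M, |A n k - auxT α (a n) M k|) atTop (nhds 0) := by
      intro n
      refine squeeze_zero (fun M => Finset.sum_nonneg fun k _ => abs_nonneg _) (fun M => ?_) (hW0 n)
      rw [Finset.sum_range_succ]
      refine le_add_of_le_of_nonneg (le_of_eq (Finset.sum_congr rfl fun k hk => ?_)) (abs_nonneg _)
      rw [hWT n M k (by simp at hk; omega)]
    have main := fun n => aux_conv (auxT α (a n)) (A n) (fracDeltaSeq α x) D hD (hs n) (herr n)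
    refine ⟨fun n => ∑' k, A n k * fracDeltaSeq α x k, fun n => ?_, C * D, fun n => ?_⟩
    · have := (main n).2
      simp only [← auxT_sum, inv2] at this
      exact this
    · have hD0 : 0 ≤ D := (abs_nonneg _).trans (hD 0)
      calc |∑' k, A n k * fracDeltaSeq α x k| ≤ ∑' k, |A n k * fracDeltaSeq α x k| :=
            norm_tsum_le_tsum_norm (f := fun k => A n k * fracDeltaSeq α x k) (main n).1
        _ ≤ ∑' k, |A n k| * D := (main n).1.tsum_le_tsum (fun k => by
            rw [abs_mul]
            exact mul_le_mul_of_nonneg_left (hD k) (abs_nonneg _)) ((hs n).mul_right D)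
        _ = (∑' k, |A n k|) * D := tsum_mul_right
        _ ≤ C * D := mul_le_mul_of_nonneg_right
            (Real.tsum_le_of_sum_range_le (fun k => abs_nonneg _) (hC n)) hD0
end

section
/- Let α be a real number with α ∉ ℤ, let X be c₀(Δ^(α)) or ℓ∞(Δ^(α)), and suppose the infinite matrix A = (a_{nk}) maps X into c₀ (the space of null sequences with the supremum norm). Then the bounded linear operator L_A : X → c₀, L_A(x) = Ax, is a compact operator if and only if lim_{r→∞} sup_{n≥r} ∑_{k=0}^∞ |â_{nk}| = 0, where â_{nk} = ∑_{j=k}^∞ (−1)^{j−k} Γ(−α+1)/((j−k)!·Γ(−α−j+k+1)) a_{nj}. -/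
open Filter Finset Topology

/-- Membership in `c₀(Δ^(α))`. -/
def memC0Delta (α : ℝ) (x : ℕ → ℝ) : Prop :=
  Tendsto (fracDeltaSeq α x) atTop (nhds 0)

/-- signed generalized binomial coefficient -/
noncomputable def gco (α : ℝ) (d : ℕ) : ℝ := (-1) ^ d * Ring.choose α d

lemma choose_rec (α : ℝ) (d : ℕ) :
    ((d : ℝ) + 1) * Ring.choose α (d + 1) = (α - d) * Ring.choose α d := by
  rw [Ring.choose_eq_smul, Ring.choose_eq_smul, descPochhammer_succ_right, Polynomial.smeval_mul,
    Polynomial.smeval_sub, Polynomial.smeval_X, Polynomial.smeval_natCast, Nat.factorial_succ]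
  have h1 : ((d : ℝ) + 1) ≠ 0 := by positivity
  have h2 : (d.factorial : ℝ) ≠ 0 := by positivity
  simp only [smul_eq_mul, pow_one, pow_zero, nsmul_eq_mul, mul_one, Nat.cast_mul, Nat.cast_add,
    Nat.cast_one]
  field_simp

lemma gamma_choose (α : ℝ) (hα : ∀ m : ℤ, α ≠ (m : ℝ)) (d : ℕ) :
    Real.Gamma (α + 1) = (d.factorial : ℝ) * Ring.choose α d * Real.Gamma (α - d + 1) := by
  induction d with
  | zero => simp
  | succ d ih =>
    rw [ih]
    have h0 : α - d ≠ 0 := by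
      intro h
      exact hα d (by push_cast; linarith)
    have h1 : α - ((d + 1 : ℕ) : ℝ) + 1 = α - d := by push_cast; ring
    rw [h1, Real.Gamma_add_one h0, Nat.factorial_succ]
    have := choose_rec α d
    push_cast
    linear_combination (-(d.factorial : ℝ) * Real.Gamma (α - d)) * this

lemma fracDelta_eq (α : ℝ) (hα : ∀ m : ℤ, α ≠ (m : ℝ)) (k d : ℕ) :
    fracDelta α (k + d) k = gco α d := by
  have hG : Real.Gamma (α - d + 1) ≠ 0 := by
    apply Real.Gamma_ne_zero
    intro m h
    exact hα ((d : ℤ) - 1 - m) (by push_cast; linarith)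
  have h2 : (d.factorial : ℝ) ≠ 0 := by positivity
  have h3 : α - ((k + d : ℕ) : ℝ) + k + 1 = α - d + 1 := by push_cast; ring
  unfold fracDelta gco
  rw [if_pos (Nat.le_add_right _ _), h3, Nat.add_sub_cancel_left, gamma_choose α hα d]
  field_simp

/-- generating series -/
noncomputable def gser (α : ℝ) : PowerSeries ℝ := PowerSeries.mk (gco α)

lemma gser_mul (α : ℝ) : gser α * gser (-α) = 1 := by
  ext n
  rw [PowerSeries.coeff_mul]
  simp only [gser, PowerSeries.coeff_mk, gco]
  have h := Ring.add_choose_eq n (Commute.all α (-α))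
  rw [add_neg_cancel, Ring.choose_zero_ite] at h
  rw [PowerSeries.coeff_one]
  calc _ = ∑ p ∈ antidiagonal n, (-1 : ℝ) ^ n * (Ring.choose α p.1 * Ring.choose (-α) p.2) := by
        refine Finset.sum_congr rfl fun p hp => ?_
        rw [← mem_antidiagonal.1 hp, pow_add]; ring
    _ = _ := by
        rw [← Finset.mul_sum, ← h]
        split_ifs with h0
        · simp [h0]
        · simp

lemma fracDeltaSeq_eq (α : ℝ) (hα : ∀ m : ℤ, α ≠ (m : ℝ)) (x : ℕ → ℝ) (n : ℕ) :
    fracDeltaSeq α x n = PowerSeries.coeff n (PowerSeries.mk x * gser α) := by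
  rw [PowerSeries.coeff_mul, Finset.Nat.sum_antidiagonal_eq_sum_range_succ_mk]
  refine Finset.sum_congr rfl fun k hk => ?_
  obtain ⟨d, rfl⟩ := Nat.exists_eq_add_of_le (Nat.lt_succ_iff.1 (mem_range.1 hk))
  simp [fracDelta_eq α hα, gser, mul_comm]

lemma fracDeltaSeq_inv (α : ℝ) (hα : ∀ m : ℤ, α ≠ (m : ℝ)) (x : ℕ → ℝ) :
    fracDeltaSeq (-α) (fracDeltaSeq α x) = x := by
  have hα' : ∀ m : ℤ, -α ≠ (m : ℝ) := fun m h => hα (-m) (by push_cast; linarith)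
  funext n
  have : PowerSeries.mk (fracDeltaSeq α x) = PowerSeries.mk x * gser α := by
    ext k; rw [PowerSeries.coeff_mk, fracDeltaSeq_eq α hα]
  rw [fracDeltaSeq_eq _ hα', this, mul_assoc, gser_mul, mul_one, PowerSeries.coeff_mk]

/-- finite section sums, transposed -/
noncomputable def csec (α : ℝ) (r : ℕ → ℝ) (m j : ℕ) : ℝ :=
  ∑ i ∈ Finset.range (m - j), fracDelta (-α) (j + i) j * r (j + i)

lemma partial_sum_eq (α : ℝ) (r y : ℕ → ℝ) (m : ℕ) :
    ∑ k ∈ Finset.range m, r k * fracDeltaSeq (-α) y k =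
      ∑ j ∈ Finset.range m, csec α r m j * y j := by
  unfold fracDeltaSeq csec
  simp only [Finset.mul_sum, Finset.sum_mul]
  rw [Finset.sum_sigma', Finset.sum_sigma']
  refine Finset.sum_bij' (fun p _ => ⟨p.2, p.1 - p.2⟩) (fun p _ => ⟨p.1 + p.2, p.1⟩) ?_ ?_ ?_ ?_ ?_
  · rintro ⟨k, j⟩ h; simp at h ⊢; omega
  · rintro ⟨k, j⟩ h; simp at h ⊢; omega
  · rintro ⟨k, j⟩ h; simp at h ⊢; omega
  · rintro ⟨k, j⟩ h; simp at h ⊢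
  · rintro ⟨k, j⟩ h
    simp at h ⊢
    rw [Nat.add_sub_cancel' (by omega)]; ring

lemma csec_tendsto (α : ℝ) (r : ℕ → ℝ) (j : ℕ) (b : ℝ)
    (h : SeriesHasSum (fun i => fracDelta (-α) (j + i) j * r (j + i)) b) :
    Tendsto (fun m => csec α r m j) atTop (𝓝 b) :=
  Tendsto.comp (g := fun m => ∑ i ∈ Finset.range m, fracDelta (-α) (j + i) j * r (j + i)) h
    (tendsto_sub_atTop_nat j)

lemma baire_inv (g : ℕ → ℕ → ℝ) (hg : ∀ j, Tendsto (fun m => g m j) atTop (𝓝 0))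
    (z w : ℕ → ℝ) (K : ℕ) (hzw : ∀ j, K ≤ j → z j = w j) (p q : ℝ)
    (hp : Tendsto (fun m => ∑ j ∈ range m, g m j * z j) atTop (𝓝 p))
    (hq : Tendsto (fun m => ∑ j ∈ range m, g m j * w j) atTop (𝓝 q)) : p = q := by
  have h1 : Tendsto (fun m => ∑ j ∈ range K, g m j * (z j - w j)) atTop (𝓝 0) := by
    have : Tendsto (fun m => ∑ j ∈ range K, g m j * (z j - w j)) atTop
        (𝓝 (∑ j ∈ range K, 0 * (z j - w j))) :=
      tendsto_finsetSum _ fun j _ => (hg j).mul_const _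
    simpa using this
  have h2 := hp.sub hq
  have h3 : Tendsto (fun m => ∑ j ∈ range K, g m j * (z j - w j)) atTop (𝓝 (p - q)) := by
    refine h2.congr' ?_
    filter_upwards [eventually_ge_atTop K] with m hm
    rw [← Finset.sum_sub_distrib]
    have : range K ⊆ range m := Finset.range_mono hm
    rw [← Finset.sum_subset this]
    · exact Finset.sum_congr rfl fun j _ => by ring
    · intro j _ hj
      rw [hzw j (by simpa using hj)]; ring
  have := tendsto_nhds_unique h3 h1
  linarith

lemma baire_key (g : ℕ → ℕ → ℝ) (C : ℝ) (hC : 0 ≤ C) (f : (ℕ → ℝ) → ℝ)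
    (hconv : ∀ z : ℕ → ℝ, (∀ k, |z k| ≤ C) →
      Tendsto (fun m => ∑ j ∈ range m, g m j * z j) atTop (𝓝 (f z)))
    (hg : ∀ j, Tendsto (fun m => g m j) atTop (𝓝 0)) :
    ∀ z : ℕ → ℝ, (∀ k, |z k| ≤ C) → f z = 0 := by
  intro z hz
  have key : ∀ ε : ℝ, 0 < ε → |f z| ≤ 2 * ε := by
    intro ε hε
    have : Nonempty (Set.Icc (-C) C) := ⟨⟨0, by constructor <;> linarith⟩⟩
    let G : ℕ → (ℕ → Set.Icc (-C) C) → ℝ := fun m y => ∑ j ∈ range m, g m j * (y j : ℝ)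
    have hGc : ∀ m, Continuous (G m) := by
      intro m
      refine continuous_finsetSum _ fun j _ => ?_
      exact continuous_const.mul (continuous_subtype_val.comp (continuous_apply j))
    let F : ℕ → Set (ℕ → Set.Icc (-C) C) := fun N => {y | ∀ m ≥ N, |G N y - G m y| ≤ ε}
    have hFc : ∀ N, IsClosed (F N) := by
      intro N
      have : F N = ⋂ m, ⋂ (_ : m ≥ N), {y | |G N y - G m y| ≤ ε} := by
        ext y; simp [F]
      rw [this]
      refine isClosed_iInter fun m => isClosed_iInter fun _ => ?_
      exact isClosed_le ((hGc N).sub (hGc m)).abs continuous_const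
    have habs : ∀ y : ℕ → Set.Icc (-C) C, ∀ k, |((y k : ℝ))| ≤ C := fun y k =>
      abs_le.2 (y k).2
    have hFU : ⋃ N, F N = Set.univ := by
      rw [Set.eq_univ_iff_forall]
      intro y
      have := (hconv (fun k => y k) (habs y)).cauchySeq
      obtain ⟨N, hN⟩ := Metric.cauchySeq_iff'.1 this ε hε
      refine Set.mem_iUnion.2 ⟨N, fun m hm => ?_⟩
      have h := hN m hm
      rw [Real.dist_eq, abs_sub_comm] at h
      exact h.le
    obtain ⟨N, y0, hy0⟩ := nonempty_interior_of_iUnion_of_closed hFc hFU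
    obtain ⟨I, u, huo, huU⟩ := isOpen_pi_iff.1 isOpen_interior y0 hy0
    obtain ⟨K0, hK0⟩ := I.exists_nat_subset_range
    let K := max K0 N
    have mem : ∀ y : ℕ → Set.Icc (-C) C, (∀ j < K, y j = y0 j) → y ∈ F N := by
      intro y hy
      apply interior_subset
      apply huU
      intro j hj
      have : j < K0 := by simpa using hK0 hj
      rw [hy j (lt_of_lt_of_le this (le_max_left _ _))]
      exact (huo j hj).2
    have lim : ∀ y ∈ F N, |G N y - f (fun k => y k)| ≤ ε := by
      intro y hy
      have := (hconv (fun k => y k) (habs y)).const_sub (G N y) |>.abs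
      refine le_of_tendsto this ?_
      filter_upwards [eventually_ge_atTop N] with m hm
      exact hy m hm
    let zz : ℕ → Set.Icc (-C) C := fun j => if j < K then y0 j else ⟨z j, abs_le.1 (hz j)⟩
    let ww : ℕ → Set.Icc (-C) C := fun j => if j < K then y0 j else ⟨0, by constructor <;> linarith⟩
    have e1 := lim zz (mem zz fun j hj => by simp [zz, hj])
    have e2 := lim ww (mem ww fun j hj => by simp [ww, hj])
    have e3 : f (fun k => zz k) = f z := by
      refine baire_inv g hg _ _ K ?_ _ _ (hconv _ (habs zz)) (hconv _ hz)
      intro j hj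
      simp [zz, not_lt.2 hj]
    have e4 : f (fun k => ww k) = 0 := by
      refine baire_inv g hg _ (fun _ => 0) K ?_ _ _ (hconv _ (habs ww)) (by simp)
      intro j hj
      simp [ww, not_lt.2 hj]
    have e5 : G N zz = G N ww := by
      refine Finset.sum_congr rfl fun j hj => ?_
      have : j < K := lt_of_lt_of_le (mem_range.1 hj) (le_max_right _ _)
      simp [zz, ww, this]
    rw [e3, e5] at e1
    rw [e4] at e2
    rw [abs_le] at e1 e2 ⊢
    constructor <;> linarith
  have : |f z| ≤ 0 := by
    refine le_of_forall_pos_le_add fun ε hε => ?_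
    have := key (ε / 2) (by linarith)
    linarith
  exact abs_eq_zero.1 (le_antisymm this (abs_nonneg _))

lemma summable_mul_bdd (c y : ℕ → ℝ) (hc : Summable fun j => |c j|) (B : ℝ) (hy : ∀ j, |y j| ≤ B) :
    Summable fun j => c j * y j := by
  refine Summable.of_norm_bounded (g := fun j => |c j| * B) (hc.mul_right B) fun j => ?_
  rw [Real.norm_eq_abs, abs_mul]
  exact mul_le_mul_of_nonneg_left (hy j) (abs_nonneg _)

lemma abs_tsum_le_bdd (c y : ℕ → ℝ) (hc : Summable fun j => |c j|) (B : ℝ) (hy : ∀ j, |y j| ≤ B) :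
    |∑' j, c j * y j| ≤ (∑' j, |c j|) * B := by
  rw [← tsum_mul_right, ← Real.norm_eq_abs]
  refine tsum_of_norm_bounded (hc.mul_right B).hasSum fun j => ?_
  rw [Real.norm_eq_abs, abs_mul]
  exact mul_le_mul_of_nonneg_left (hy j) (abs_nonneg _)

lemma null_bdd (y : ℕ → ℝ) (hy : Tendsto y atTop (𝓝 0)) : ∃ B, ∀ j, |y j| ≤ B := by
  obtain ⟨B, hB⟩ := hy.abs.bddAbove_range
  exact ⟨B, fun j => hB ⟨j, rfl⟩⟩

/-- test sequence -/
noncomputable def tst (c : ℕ → ℝ) (N j : ℕ) : ℝ := if j < N then SignType.sign (c j) else 0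

lemma tst_abs (c : ℕ → ℝ) (N j : ℕ) : |tst c N j| ≤ 1 := by
  unfold tst
  split_ifs
  · rcases lt_trichotomy (c j) 0 with h | h | h <;> simp [h]
  · simp

lemma tst_null (c : ℕ → ℝ) (N : ℕ) : Tendsto (tst c N) atTop (𝓝 0) := by
  refine tendsto_const_nhds.congr' ?_
  filter_upwards [eventually_ge_atTop N] with j hj
  simp [tst, not_lt.2 hj]

lemma tst_sum (c : ℕ → ℝ) (N : ℕ) : ∑' j, c j * tst c N j = ∑ j ∈ range N, |c j| := by
  rw [tsum_eq_sum (s := range N)]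
  · refine Finset.sum_congr rfl fun j hj => ?_
    simp [tst, mem_range.1 hj]
  · intro j hj
    simp at hj
    simp [tst, not_lt.2 hj]

lemma bs_lemma (c : ℕ → ℕ → ℝ) (hc : ∀ m, Summable fun j => |c m j|)
    (hb : ∀ y : ℕ → ℝ, Tendsto y atTop (𝓝 0) → ∃ C, ∀ m, |∑' j, c m j * y j| ≤ C) :
    ∃ M, ∀ m, ∑' j, |c m j| ≤ M := by
  have hnull : ∀ y : ZeroAtInftyContinuousMap ℕ ℝ, Tendsto (fun j => y j) atTop (𝓝 0) := by
    intro y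
    have := y.zero_at_infty'
    rwa [cocompact_eq_cofinite, Nat.cofinite_eq_atTop] at this
  have hle : ∀ (y : ZeroAtInftyContinuousMap ℕ ℝ) j, |y j| ≤ ‖y‖ := by
    intro y j
    rw [← ZeroAtInftyContinuousMap.norm_toBCF_eq_norm]
    exact y.toBCF.norm_coe_le_norm j
  let T : ℕ → ZeroAtInftyContinuousMap ℕ ℝ →L[ℝ] ℝ := fun m =>
    LinearMap.mkContinuous
      { toFun := fun y => ∑' j, c m j * y j
        map_add' := fun x y => by
          rw [← Summable.tsum_add (summable_mul_bdd _ _ (hc m) _ (hle x))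
            (summable_mul_bdd _ _ (hc m) _ (hle y))]
          exact tsum_congr fun j => by simp [mul_add]
        map_smul' := fun r y => by
          simp only [ZeroAtInftyContinuousMap.smul_apply, smul_eq_mul, RingHom.id_apply]
          rw [← tsum_mul_left]
          exact tsum_congr fun j => by ring } (∑' j, |c m j|)
      (fun y => abs_tsum_le_bdd _ _ (hc m) _ (hle y))
  have hT : ∀ m y, T m y = ∑' j, c m j * y j := fun m y => rfl
  obtain ⟨M, hM⟩ := banach_steinhaus (g := T) (fun y => by
    obtain ⟨C, hC⟩ := hb (fun j => y j) (hnull y)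
    exact ⟨C, fun m => hC m⟩)
  refine ⟨M, fun m => ?_⟩
  have hM0 : 0 ≤ M := (norm_nonneg _).trans (hM 0)
  refine (hc m).tsum_le_of_sum_range_le  fun N => ?_
  let y : ZeroAtInftyContinuousMap ℕ ℝ :=
    ⟨⟨tst (c m) N, continuous_of_discreteTopology⟩, by
      rw [cocompact_eq_cofinite, Nat.cofinite_eq_atTop]; exact tst_null _ _⟩
  have hy1 : ‖y‖ ≤ 1 := by
    rw [← ZeroAtInftyContinuousMap.norm_toBCF_eq_norm]
    exact (BoundedContinuousFunction.norm_le zero_le_one).2 fun j => tst_abs _ _ _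
  have h1 : T m y = ∑ j ∈ range N, |c m j| := tst_sum _ _
  rw [← h1]
  calc T m y ≤ ‖T m y‖ := le_abs_self _
    _ ≤ ‖T m‖ * ‖y‖ := (T m).le_opNorm y
    _ ≤ M * 1 := mul_le_mul (hM m) hy1 (norm_nonneg _) hM0
    _ = M := mul_one M

lemma null_conv (d : ℕ → ℕ → ℝ) (hd : ∀ m, Summable fun j => |d m j|) (M : ℝ)
    (hM : ∀ m, ∑' j, |d m j| ≤ M) (h0 : ∀ j, Tendsto (fun m => d m j) atTop (𝓝 0))
    (y : ℕ → ℝ) (hy : Tendsto y atTop (𝓝 0)) :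
    Tendsto (fun m => ∑' j, d m j * y j) atTop (𝓝 0) := by
  have hM0 : 0 ≤ M := (tsum_nonneg fun j => abs_nonneg _).trans (hM 0)
  rw [Metric.tendsto_atTop']
  intro ε hε
  obtain ⟨δ, hδ, hδM⟩ : ∃ δ : ℝ, 0 < δ ∧ δ * M < ε / 2 := by
    refine ⟨ε / (2 * (M + 1)), by positivity, ?_⟩
    rw [div_mul_eq_mul_div, div_lt_div_iff₀ (by positivity) (by positivity)]
    nlinarith
  obtain ⟨N, hN⟩ := Metric.tendsto_atTop.1 hy δ hδ
  have h1 : Tendsto (fun m => ∑ j ∈ range N, |d m j| * |y j|) atTop (𝓝 0) := by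
    have : Tendsto (fun m => ∑ j ∈ range N, |d m j| * |y j|) atTop
        (𝓝 (∑ j ∈ range N, |(0 : ℝ)| * |y j|)) :=
      tendsto_finsetSum _ fun j _ => ((h0 j).abs).mul_const _
    simpa using this
  obtain ⟨m0, hm0⟩ := eventually_atTop.1 (h1.eventually (gt_mem_nhds (half_pos hε)))
  refine ⟨m0, fun m hm => ?_⟩
  rw [dist_zero_right]
  have hfin : HasSum (fun j => if j ∈ range N then |d m j| * |y j| else 0)
      (∑ j ∈ range N, |d m j| * |y j|) := by
    have := hasSum_sum_of_ne_finset_zero (L := SummationFilter.unconditional ℕ)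
      (f := fun j => if j ∈ range N then |d m j| * |y j| else 0) (s := range N)
      (fun j hj => if_neg hj)
    convert this using 1
    exact Finset.sum_congr rfl fun j hj => by rw [if_pos hj]
  have h2 : ‖∑' j, d m j * y j‖ ≤ (∑ j ∈ range N, |d m j| * |y j|) + δ * ∑' j, |d m j| := by
    refine tsum_of_norm_bounded (hfin.add ((hd m).hasSum.mul_left δ)) fun j => ?_
    rw [Real.norm_eq_abs, abs_mul]
    have hnn : 0 ≤ δ * |d m j| := by positivity
    split_ifs with hj
    · linarith
    · have := hN j (by simpa using hj)
      rw [dist_zero_right, Real.norm_eq_abs] at this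
      rw [zero_add, mul_comm δ]
      exact mul_le_mul_of_nonneg_left this.le (abs_nonneg _)
  have h3 := hm0 m hm.le
  have h4 : δ * ∑' j, |d m j| ≤ δ * M := mul_le_mul_of_nonneg_left (hM m) hδ.le
  linarith

lemma key_c0 (c : ℕ → ℕ → ℝ) (b : ℕ → ℝ) (hc : ∀ j, Tendsto (fun m => c m j) atTop (𝓝 (b j)))
    (hconv : ∀ y : ℕ → ℝ, Tendsto y atTop (𝓝 0) →
      ∃ L, Tendsto (fun m => ∑ j ∈ range m, c m j * y j) atTop (𝓝 L)) :
    (Summable fun j => |b j|) ∧ ∀ y : ℕ → ℝ, Tendsto y atTop (𝓝 0) →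
      Tendsto (fun m => ∑ j ∈ range m, c m j * y j) atTop (𝓝 (∑' j, b j * y j)) := by
  let ct : ℕ → ℕ → ℝ := fun m j => if j ∈ range m then c m j else 0
  have hct : ∀ m, Summable fun j => |ct m j| := fun m =>
    summable_of_ne_finset_zero (s := range m) fun j hj => by simp only [ct, if_neg hj, abs_zero]
  have hsum : ∀ m (y : ℕ → ℝ), ∑' j, ct m j * y j = ∑ j ∈ range m, c m j * y j := by
    intro m y
    rw [tsum_eq_sum (s := range m)]
    · exact Finset.sum_congr rfl fun j hj => by simp only [ct, if_pos hj]
    · intro j hj; simp only [ct, if_neg hj, zero_mul]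
  have hctb : ∀ j, Tendsto (fun m => ct m j) atTop (𝓝 (b j)) := by
    intro j
    refine (hc j).congr' ?_
    filter_upwards [eventually_gt_atTop j] with m hm
    simp [ct, hm]
  obtain ⟨M, hM⟩ := bs_lemma ct hct (fun y hy => by
    obtain ⟨L, hL⟩ := hconv y hy
    obtain ⟨B, hB⟩ := hL.abs.bddAbove_range
    exact ⟨B, fun m => by rw [hsum]; exact hB ⟨m, rfl⟩⟩)
  have hbs : ∀ u : Finset ℕ, ∑ j ∈ u, |b j| ≤ M := by
    intro u
    have : Tendsto (fun m => ∑ j ∈ u, |ct m j|) atTop (𝓝 (∑ j ∈ u, |b j|)) :=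
      tendsto_finsetSum _ fun j _ => (hctb j).abs
    refine le_of_tendsto' this fun m => ?_
    exact ((hct m).sum_le_tsum u fun j _ => abs_nonneg _).trans (hM m)
  have hb : Summable fun j => |b j| := summable_of_sum_le (fun j => abs_nonneg _) hbs
  have hbM : ∑' j, |b j| ≤ M := hb.tsum_le_of_sum_le hbs
  refine ⟨hb, fun y hy => ?_⟩
  obtain ⟨B, hB⟩ := null_bdd y hy
  have hdle : ∀ m j, |ct m j - b j| ≤ |ct m j| + |b j| := fun m j => abs_sub _ _
  have hd : ∀ m, Summable fun j => |ct m j - b j| := fun m =>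
    Summable.of_nonneg_of_le (fun j => abs_nonneg _) (hdle m) ((hct m).add hb)
  have h := null_conv (fun m j => ct m j - b j) hd (M + M) (fun m => by
    calc _ ≤ ∑' j, (|ct m j| + |b j|) := (hd m).tsum_le_tsum (hdle m) ((hct m).add hb)
      _ = _ := (hct m).tsum_add hb
      _ ≤ _ := add_le_add (hM m) hbM)
    (fun j => by simpa using (hctb j).sub_const (b j)) y hy
  have h' := h.add_const (∑' j, b j * y j)
  rw [zero_add] at h'
  refine h'.congr fun m => ?_
  rw [← hsum, ← Summable.tsum_add (summable_mul_bdd _ _ (hd m) B hB) (summable_mul_bdd _ _ hb B hB)]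
  exact tsum_congr fun j => by ring

lemma key_linf (c : ℕ → ℕ → ℝ) (b : ℕ → ℝ) (hc : ∀ j, Tendsto (fun m => c m j) atTop (𝓝 (b j)))
    (hb : Summable fun j => |b j|)
    (hconv : ∀ y : ℕ → ℝ, (∃ C, ∀ j, |y j| ≤ C) →
      ∃ L, Tendsto (fun m => ∑ j ∈ range m, c m j * y j) atTop (𝓝 L))
    (y : ℕ → ℝ) (hy : ∃ C, ∀ j, |y j| ≤ C) :
      Tendsto (fun m => ∑ j ∈ range m, c m j * y j) atTop (𝓝 (∑' j, b j * y j)) := by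
  obtain ⟨C, hC⟩ := hy
  choose! L hL using hconv
  have := baire_key (fun m j => c m j - b j) C ((abs_nonneg _).trans (hC 0))
    (fun z => L z - ∑' j, b j * z j) (fun z hz => by
      have h1 := (hL z ⟨C, hz⟩).sub (summable_mul_bdd b z hb C hz).hasSum.tendsto_sum_nat
      refine h1.congr fun m => ?_
      rw [← Finset.sum_sub_distrib]
      exact Finset.sum_congr rfl fun j _ => by ring)
    (fun j => by simpa using (hc j).sub_const (b j)) y hC
  have h2 := hL y ⟨C, hC⟩
  rwa [sub_eq_zero.1 this] at h2

lemma backward (b : ℕ → ℕ → ℝ) (hb : ∀ n, Summable fun k => |b n k|)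
    (hR : Tendsto (fun n => ∑' k, |b n k|) atTop (𝓝 0)) (v : ℕ → ℕ → ℝ) (C : ℝ)
    (hv : ∀ i k, |v i k| ≤ C) :
    ∃ φ : ℕ → ℕ, StrictMono φ ∧ ∃ y : ℕ → ℝ, Tendsto y atTop (𝓝 0) ∧
      Tendsto (fun i => ⨆ n, |(∑' k, b n k * v (φ i) k) - y n|) atTop (𝓝 0) := by
  have hC : 0 ≤ C := (abs_nonneg _).trans (hv 0 0)
  have hcomp : IsCompact (Set.pi Set.univ fun _ : ℕ => Set.Icc (-C) C) :=
    isCompact_univ_pi fun _ => isCompact_Icc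
  obtain ⟨w, hw, φ, hφ, hlim⟩ := hcomp.tendsto_subseq (x := v)
    (fun i => fun k _ => abs_le.1 (hv i k))
  have hwC : ∀ k, |w k| ≤ C := fun k => abs_le.2 (hw k (Set.mem_univ k))
  rw [tendsto_pi_nhds] at hlim
  refine ⟨φ, hφ, fun n => ∑' k, b n k * w k, ?_, ?_⟩
  · refine squeeze_zero_norm (fun n => abs_tsum_le_bdd _ _ (hb n) C hwC) ?_
    simpa using hR.mul_const C
  · have hpt : ∀ n, Tendsto (fun i => |(∑' k, b n k * v (φ i) k) - ∑' k, b n k * w k|) atTop (𝓝 0) := by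
      intro n
      have : Tendsto (fun i => ∑' k, b n k * v (φ i) k) atTop (𝓝 (∑' k, b n k * w k)) := by
        refine tendsto_tsum_of_dominated_convergence (bound := fun k => |b n k| * C)
          ((hb n).mul_right C) (fun k => (hlim k).const_mul _) (Eventually.of_forall fun i k => ?_)
        rw [Real.norm_eq_abs, abs_mul]
        exact mul_le_mul_of_nonneg_left (hv _ _) (abs_nonneg _)
      simpa using (this.sub_const (∑' k, b n k * w k)).abs
    rw [Metric.tendsto_atTop']
    intro ε hε
    have hRC : Tendsto (fun n => (∑' k, |b n k|) * C + (∑' k, |b n k|) * C) atTop (𝓝 0) := by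
      simpa using (hR.mul_const C).add (hR.mul_const C)
    obtain ⟨r, hr⟩ := eventually_atTop.1 (hRC.eventually (gt_mem_nhds (half_pos hε)))
    have hfin : ∀ᶠ i in atTop, ∀ n ∈ range r,
        |(∑' k, b n k * v (φ i) k) - ∑' k, b n k * w k| < ε / 2 :=
      (Finset.eventually_all _).2 fun n _ => (hpt n).eventually (gt_mem_nhds (half_pos hε))
    obtain ⟨i0, hi0⟩ := eventually_atTop.1 hfin
    refine ⟨i0, fun i hi => ?_⟩
    rw [dist_zero_right, Real.norm_of_nonneg (Real.iSup_nonneg fun n => abs_nonneg _)]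
    refine lt_of_le_of_lt (ciSup_le fun n => ?_) (half_lt_self hε)
    by_cases hn : n < r
    · exact (hi0 i hi.le n (mem_range.2 hn)).le
    · have h1 := abs_tsum_le_bdd _ _ (hb n) C (hv (φ i))
      have h2 := abs_tsum_le_bdd _ _ (hb n) C hwC
      have h3 := hr n (not_lt.1 hn)
      have h4 := abs_sub (∑' k, b n k * v (φ i) k) (∑' k, b n k * w k)
      linarith

lemma sup_tail_iff (R : ℕ → ℝ) (h0 : ∀ n, 0 ≤ R n) (M : ℝ) (hM : ∀ n, R n ≤ M) :
    Tendsto (fun r => ⨆ n : {n : ℕ // r ≤ n}, R (n : ℕ)) atTop (𝓝 0) ↔ Tendsto R atTop (𝓝 0) := by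
  constructor
  · intro h
    refine squeeze_zero h0 (fun r => ?_) h
    exact le_ciSup (f := fun n : {n : ℕ // r ≤ n} => R (n : ℕ))
      ⟨M, by rintro _ ⟨n, rfl⟩; exact hM n⟩ ⟨r, le_rfl⟩
  · intro h
    rw [Metric.tendsto_atTop'] at h ⊢
    intro ε hε
    obtain ⟨N, hN⟩ := h (ε / 2) (half_pos hε)
    refine ⟨N, fun r hr => ?_⟩
    rw [dist_zero_right, Real.norm_of_nonneg (Real.iSup_nonneg fun n => h0 _)]
    have : Nonempty {n : ℕ // r ≤ n} := ⟨⟨r, le_rfl⟩⟩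
    refine lt_of_le_of_lt (ciSup_le fun n => ?_) (half_lt_self hε)
    have := hN n (lt_of_lt_of_le hr n.2)
    rw [dist_zero_right, Real.norm_of_nonneg (h0 _)] at this
    exact this.le

/-- Let `X ∈ {c₀(Δ^(α)), ℓ∞(Δ^(α))}` and `A ∈ (X, c₀)`. Then `L_A` is compact iff
`lim_r sup_{n≥r} ∑_k |â_{nk}| = 0`. -/
theorem compact_into_c0 (α : ℝ) (hα : ∀ m : ℤ, α ≠ (m : ℝ))
    (X : Set (ℕ → ℝ))
    (hX : X = {x | memC0Delta α x} ∨ X = {x | memLinfDelta α x})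
    (a : ℕ → ℕ → ℝ)
    (hrows : ∀ x ∈ X, ∀ n : ℕ, ∃ L : ℝ, SeriesHasSum (fun k => a n k * x k) L)
    (hmaps : ∀ x ∈ X, Tendsto (matMul a x) atTop (nhds 0))
    (Ahat : ℕ → ℕ → ℝ)
    (hAhat : ∀ n k, SeriesHasSum (fun j => fracDelta (-α) (k + j) k * a n (k + j)) (Ahat n k)) :
    (∀ u : ℕ → (ℕ → ℝ), (∀ i, u i ∈ X) → (∃ C : ℝ, ∀ i, deltaNorm α (u i) ≤ C) →
      ∃ φ : ℕ → ℕ, StrictMono φ ∧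
        ∃ y : ℕ → ℝ, Tendsto y atTop (nhds 0) ∧
          Tendsto (fun i => ⨆ n, |matMul a (u (φ i)) n - y n|) atTop (nhds 0)) ↔
    Tendsto (fun r => ⨆ n : {n : ℕ // r ≤ n}, ∑' k, |Ahat (n : ℕ) k|) atTop (nhds 0) := by
  have hα' : ∀ m : ℤ, -α ≠ (m : ℝ) := fun m h => hα (-m) (by push_cast; linarith)
  have inv1 := fracDeltaSeq_inv α hα
  have inv2 : ∀ y, fracDeltaSeq α (fracDeltaSeq (-α) y) = y := by
    intro y
    have := fracDeltaSeq_inv (-α) hα' y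
    rwa [neg_neg] at this
  have hXc0 : ∀ y : ℕ → ℝ, Tendsto y atTop (𝓝 0) → fracDeltaSeq (-α) y ∈ X := by
    intro y hy
    rcases hX with rfl | rfl
    · change Tendsto (fracDeltaSeq α (fracDeltaSeq (-α) y)) atTop (𝓝 0)
      rwa [inv2]
    · change ∃ C : ℝ, ∀ n, |fracDeltaSeq α (fracDeltaSeq (-α) y) n| ≤ C
      rw [inv2]
      exact null_bdd y hy
  have hXb : ∀ x ∈ X, ∃ C : ℝ, ∀ n, |fracDeltaSeq α x n| ≤ C := by
    intro x hx
    rcases hX with rfl | rfl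
    · exact null_bdd _ hx
    · exact hx
  have hconv : ∀ y, fracDeltaSeq (-α) y ∈ X → ∀ n,
      ∃ L, Tendsto (fun m => ∑ j ∈ range m, csec α (a n) m j * y j) atTop (𝓝 L) := by
    intro y hy n
    obtain ⟨L, hL⟩ := hrows _ hy n
    exact ⟨L, Tendsto.congr (fun m => partial_sum_eq α (a n) y m) hL⟩
  have hcs : ∀ n j, Tendsto (fun m => csec α (a n) m j) atTop (𝓝 (Ahat n j)) := fun n j =>
    csec_tendsto α (a n) j _ (hAhat n j)
  have hkey := fun n => key_c0 (csec α (a n)) (Ahat n) (hcs n) (fun y hy => hconv y (hXc0 y hy) n)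
  have hb : ∀ n, Summable fun k => |Ahat n k| := fun n => (hkey n).1
  have hlim : ∀ x ∈ X, ∀ n, matMul a x n = ∑' k, Ahat n k * fracDeltaSeq α x k := by
    intro x hx n
    have h1 : Tendsto (fun m => ∑ j ∈ range m, csec α (a n) m j * fracDeltaSeq α x j) atTop
        (𝓝 (∑' k, Ahat n k * fracDeltaSeq α x k)) := by
      rcases hX with rfl | rfl
      · exact (hkey n).2 _ hx
      · refine key_linf _ _ (hcs n) (hb n) (fun y hy => hconv y ?_ n) _ hx
        change ∃ C : ℝ, ∀ n, |fracDeltaSeq α (fracDeltaSeq (-α) y) n| ≤ C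
        rwa [inv2]
    have h2 : Tendsto (fun m => ∑ k ∈ range m, a n k * x k) atTop
        (𝓝 (∑' k, Ahat n k * fracDeltaSeq α x k)) := by
      refine h1.congr fun m => ?_
      rw [← partial_sum_eq, inv1]
    exact h2.limUnder_eq
  have hlim0 : ∀ y : ℕ → ℝ, Tendsto y atTop (𝓝 0) → ∀ n,
      matMul a (fracDeltaSeq (-α) y) n = ∑' k, Ahat n k * y k := by
    intro y hy n
    rw [hlim _ (hXc0 y hy), inv2]
  obtain ⟨M, hM⟩ := bs_lemma Ahat hb (fun y hy => by
    obtain ⟨C, hC⟩ := null_bdd _ (hmaps _ (hXc0 y hy))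
    exact ⟨C, fun n => by rw [← hlim0 y hy]; exact hC n⟩)
  have hR0 : ∀ n, 0 ≤ ∑' k, |Ahat n k| := fun n => tsum_nonneg fun k => abs_nonneg _
  rw [sup_tail_iff (fun n => ∑' k, |Ahat n k|) hR0 M hM]
  constructor
  · intro hcpt
    by_contra hnot
    rw [Metric.tendsto_atTop] at hnot
    push Not at hnot
    obtain ⟨ε, hε, hn⟩ := hnot
    choose ν hν hνε using hn
    have hN : ∀ i, ∃ N, ε / 2 < ∑ j ∈ range N, |Ahat (ν i) j| := by
      intro i
      have h1 := hνε i
      rw [dist_zero_right, Real.norm_of_nonneg (hR0 _)] at h1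
      have h2 := (hb (ν i)).hasSum.tendsto_sum_nat
      exact (h2.eventually (lt_mem_nhds (lt_of_lt_of_le (half_lt_self hε) h1))).exists
    choose N hN using hN
    obtain ⟨φ, hφ, y, hy, hlimy⟩ := hcpt (fun i => fracDeltaSeq (-α) (tst (Ahat (ν i)) (N i)))
      (fun i => hXc0 _ (tst_null _ _))
      ⟨1, fun i => by
        unfold deltaNorm
        rw [inv2]
        exact ciSup_le fun n => tst_abs _ _ _⟩
    have hνt : Tendsto (fun i => ν (φ i)) atTop atTop :=
      tendsto_atTop_mono (fun i => (hφ.id_le i).trans (hν (φ i))) tendsto_id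
    have hz := hlimy.add (hy.comp hνt)
    rw [add_zero] at hz
    obtain ⟨i, hi⟩ := (hz.eventually (gt_mem_nhds (half_pos hε))).exists
    have hmem := hXc0 _ (tst_null (Ahat (ν (φ i))) (N (φ i)))
    have hsub := (hmaps _ hmem).sub hy
    rw [sub_zero] at hsub
    obtain ⟨B, hB⟩ := null_bdd _ hsub
    have h1 := le_ciSup (f := fun n =>
      |matMul a (fracDeltaSeq (-α) (tst (Ahat (ν (φ i))) (N (φ i)))) n - y n|)
      ⟨B, by rintro _ ⟨n, rfl⟩; exact hB n⟩ (ν (φ i))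
    have h2 := hN (φ i)
    rw [← tst_sum, ← hlim0 _ (tst_null _ _)] at h2
    have h3 := le_abs_self (matMul a (fracDeltaSeq (-α) (tst (Ahat (ν (φ i))) (N (φ i)))) (ν (φ i))
      - y (ν (φ i)))
    simp only [Function.comp_apply] at hi h1
    linarith
  · intro hR u hu ⟨C, hC⟩
    have hv : ∀ i k, |fracDeltaSeq α (u i) k| ≤ C := by
      intro i k
      obtain ⟨B, hB⟩ := hXb _ (hu i)
      exact (le_ciSup (f := fun n => |fracDeltaSeq α (u i) n|)
        ⟨B, by rintro _ ⟨n, rfl⟩; exact hB n⟩ k).trans (hC i)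
    obtain ⟨φ, hφ, y, hy, h⟩ := backward Ahat hb hR (fun i => fracDeltaSeq α (u i)) C hv
    refine ⟨φ, hφ, y, hy, h.congr fun i => ?_⟩
    exact iSup_congr fun n => by rw [hlim _ (hu _)]
end

section
/- Let α be a real number with α ∉ ℤ and suppose the infinite matrix A = (a_{nk}) maps c(Δ^(α)) into c₀ (the space of null sequences with the supremum norm). Then the bounded linear operator L_A : c(Δ^(α)) → c₀, L_A(x) = Ax, is a compact operator if and only if lim_{r→∞} sup_{n≥r} ( ∑_{k=0}^∞ |â_{nk}| + |γ_n| ) = 0, where â_{nk} = ∑_{j=k}^∞ (−1)^{j−k} Γ(−α+1)/((j−k)!·Γ(−α−j+k+1)) a_{nj} and γ_n = lim_{m→∞} ∑_{k=0}^{m} w^{(A_n)}_{mk} with w^{(A_n)}_{mk} = ∑_{j=m}^∞ (−1)^{j−k} Γ(−α+1)/((j−k)!·Γ(−α−j+k+1)) a_{nj} for 0 ≤ k ≤ m. -/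
open Filter Finset Topology

lemma gamma_desc (α : ℝ) (hα : ∀ m : ℤ, α ≠ (m : ℝ)) (j : ℕ) :
    Real.Gamma (α + 1) = (descPochhammer ℤ j).smeval α * Real.Gamma (α - j + 1) := by
  induction j with
  | zero => simp
  | succ j ih =>
    rw [ih, descPochhammer_succ_right, Polynomial.smeval_mul]
    have h : α - j ≠ 0 := by
      intro h; exact hα j (by push_cast; linarith)
    rw [Real.Gamma_add_one h]
    simp only [Polynomial.smeval_sub, Polynomial.smeval_X, Polynomial.smeval_natCast]
    push_cast
    rw [show α - (j + 1 : ℝ) + 1 = α - j by ring]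
    simp
    ring

lemma fracDelta_eq_s18 (α : ℝ) (hα : ∀ m : ℤ, α ≠ (m : ℝ)) (n k : ℕ) (h : k ≤ n) :
    fracDelta α n k = (-1) ^ (n - k) * Ring.choose α (n - k) := by
  rw [fracDelta, if_pos h, Ring.choose_eq_smul, gamma_desc α hα (n - k)]
  have e : α - n + k + 1 = α - ((n - k : ℕ) : ℝ) + 1 := by
    rw [Nat.cast_sub h]; ring
  rw [e]
  have hG : Real.Gamma (α - ((n - k : ℕ) : ℝ) + 1) ≠ 0 := by
    apply Real.Gamma_ne_zero
    intro m hm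
    apply hα (((n - k : ℕ) : ℤ) - 1 - m)
    push_cast
    linarith
  have hf : ((n - k).factorial : ℝ) ≠ 0 := by positivity
  simp only [smul_eq_mul]
  field_simp

lemma fracDeltaSeq_mk (α : ℝ) (hα : ∀ m : ℤ, α ≠ (m : ℝ)) (x : ℕ → ℝ) :
    PowerSeries.mk (fracDeltaSeq α x) =
      PowerSeries.rescale (-1 : ℝ) (PowerSeries.binomialSeries ℝ α) * PowerSeries.mk x := by
  ext n
  rw [mul_comm, PowerSeries.coeff_mul, PowerSeries.coeff_mk, fracDeltaSeq,
    Finset.Nat.sum_antidiagonal_eq_sum_range_succ_mk]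
  apply Finset.sum_congr rfl
  intro k hk
  have hk' : k ≤ n := by simpa [Nat.lt_succ_iff] using hk
  rw [fracDelta_eq_s18 α hα n k hk']
  simp
  ring

/-- Approximate norming sequences for functionals on `c`. -/
lemma exists_norming (t : ℕ → ℝ) (ht : Summable fun k => |t k|) (g : ℝ) (ε : ℝ) (hε : 0 < ε) :
    ∃ (y : ℕ → ℝ) (l : ℝ), (∀ k, |y k| ≤ 1) ∧ |l| ≤ 1 ∧ Tendsto y atTop (𝓝 l) ∧
      (∑' k, |t k|) + |g| - ε ≤ |(∑' k, t k * y k) - g * l| := by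
  have htail := tendsto_sum_nat_add (fun k => |t k|)
  obtain ⟨N, hN⟩ := (htail.eventually (gt_mem_nhds (half_pos hε))).exists
  have hs : ∀ x : ℝ, |(SignType.sign x : ℝ)| ≤ 1 := by
    intro x
    rcases lt_trichotomy x 0 with h | h | h <;> simp [h]
  have hm : ∀ x : ℝ, x * (SignType.sign x : ℝ) = |x| := by
    intro x
    rcases lt_trichotomy x 0 with h | h | h <;> simp [h, abs_of_neg, abs_of_pos]
  set l : ℝ := -(SignType.sign g : ℝ) with hl
  have hl1 : |l| ≤ 1 := by rw [hl, abs_neg]; exact hs g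
  set y : ℕ → ℝ := fun k => if k < N then (SignType.sign (t k) : ℝ) else l with hy
  have hy1 : ∀ k, |y k| ≤ 1 := by
    intro k
    by_cases h : k < N
    · simp only [hy, if_pos h]; exact hs _
    · simp only [hy, if_neg h]; exact hl1
  refine ⟨y, l, hy1, hl1, ?_, ?_⟩
  · refine tendsto_const_nhds.congr' ?_
    filter_upwards [eventually_ge_atTop N] with k hk
    simp [hy, not_lt.mpr hk]
  · have hb : ∀ k, |t k * y k| ≤ |t k| := fun k => by
      rw [abs_mul]; exact mul_le_of_le_one_right (abs_nonneg _) (hy1 k)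
    have hsum : Summable fun k => t k * y k :=
      (Summable.of_nonneg_of_le (fun _ => abs_nonneg _) hb ht).of_abs
    have e1 := hsum.sum_add_tsum_nat_add N
    have e2 := ht.sum_add_tsum_nat_add N
    have e3 : ∑ k ∈ range N, t k * y k = ∑ k ∈ range N, |t k| := by
      apply Finset.sum_congr rfl
      intro k hk
      simp only [hy, if_pos (Finset.mem_range.mp hk)]
      exact hm _
    have hsN : Summable fun k => |t (k + N)| := (summable_nat_add_iff (f := fun k => |t k|) N).mpr ht
    have hsN2 : Summable fun k => t (k + N) * y (k + N) :=
      (summable_nat_add_iff (f := fun k => t k * y k) N).mpr hsum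
    have e4 : -(∑' k, |t (k + N)|) ≤ ∑' k, t (k + N) * y (k + N) := by
      rw [← tsum_neg]
      refine Summable.tsum_le_tsum (fun k => ?_) hsN.neg hsN2
      have h2 := neg_abs_le (t (k + N) * y (k+N))
      linarith [hb (k+N)]
    have e5 : g * l = -|g| := by rw [hl, mul_neg, hm]
    refine le_trans ?_ (le_abs_self _)
    rw [e5, ← e1, ← e2, e3]
    linarith

lemma tsum_le_of_bound (t : ℕ → ℝ) (ht : Summable fun k => |t k|) (y : ℕ → ℝ) (C : ℝ)
    (hy : ∀ k, |y k| ≤ C) (g l : ℝ) (hl : |l| ≤ C) :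
    |(∑' k, t k * y k) - g * l| ≤ ((∑' k, |t k|) + |g|) * C := by
  have hb : ∀ k, ‖t k * y k‖ ≤ |t k| * C := fun k => by
    rw [Real.norm_eq_abs, abs_mul]; exact mul_le_mul_of_nonneg_left (hy k) (abs_nonneg _)
  have h1 := tsum_of_norm_bounded (ht.mul_right C).hasSum hb
  rw [tsum_mul_right, Real.norm_eq_abs] at h1
  have h2 : |g * l| ≤ |g| * C := by
    rw [abs_mul]; exact mul_le_mul_of_nonneg_left hl (abs_nonneg _)
  calc _ ≤ |∑' k, t k * y k| + |g * l| := abs_sub _ _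
    _ ≤ _ := by linarith

lemma summable_mul_of_bound (t : ℕ → ℝ) (ht : Summable fun k => |t k|) (y : ℕ → ℝ) (C : ℝ)
    (hy : ∀ k, |y k| ≤ C) : Summable fun k => t k * y k := by
  refine Summable.of_norm_bounded (ht.mul_right C) fun k => ?_
  rw [Real.norm_eq_abs, abs_mul]; exact mul_le_mul_of_nonneg_left (hy k) (abs_nonneg _)

/-- Uniform boundedness for functionals on `c`. -/
lemma unif_bound (t : ℕ → ℕ → ℝ) (ht : ∀ i, Summable fun k => |t i k|) (g : ℕ → ℝ)
    (h : ∀ (y : ℕ → ℝ) (l : ℝ), Tendsto y atTop (𝓝 l) →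
      ∃ C, ∀ i, |(∑' k, t i k * y k) - g i * l| ≤ C) :
    ∃ C, ∀ i, (∑' k, |t i k|) + |g i| ≤ C := by
  have hn : ∀ (f : C(OnePoint ℕ, ℝ)) (k : OnePoint ℕ), |f k| ≤ ‖f‖ := fun f k => f.norm_coe_le_norm k
  let F : ℕ → (C(OnePoint ℕ, ℝ) →L[ℝ] ℝ) := fun i =>
    LinearMap.mkContinuous
      { toFun := fun f => (∑' k : ℕ, t i k * f (k : OnePoint ℕ)) - g i * f OnePoint.infty
        map_add' := by
          intro f f'
          have a1 := summable_mul_of_bound (t i) (ht i) (fun k => f (k : OnePoint ℕ)) _ (fun k => hn f k)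
          have a2 := summable_mul_of_bound (t i) (ht i) (fun k => f' (k : OnePoint ℕ)) _ (fun k => hn f' k)
          simp only [ContinuousMap.add_apply, mul_add]
          rw [a1.tsum_add a2]
          ring
        map_smul' := by
          intro c f
          simp only [ContinuousMap.smul_apply, smul_eq_mul, RingHom.id_apply]
          rw [mul_sub, ← tsum_mul_left]
          congr 1
          · congr 1; funext k; ring
          · ring }
      ((∑' k, |t i k|) + |g i|)
      (fun f => tsum_le_of_bound (t i) (ht i) _ _ (fun k => hn f k) _ _ (hn f _))
  have hF : ∀ i f, F i f = (∑' k : ℕ, t i k * f (k : OnePoint ℕ)) - g i * f OnePoint.infty :=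
    fun i f => rfl
  obtain ⟨C, hC⟩ := banach_steinhaus (g := F) (by
    intro f
    obtain ⟨C, hC⟩ := h (fun k => f (k : OnePoint ℕ)) (f OnePoint.infty) (by
      exact (OnePoint.continuous_iff_from_nat f).mp f.continuous)
    exact ⟨C, fun i => by rw [hF]; exact hC i⟩)
  refine ⟨C + 1, fun i => ?_⟩
  obtain ⟨y, l, hy, hl, hyl, hb⟩ := exists_norming (t i) (ht i) (g i) 1 one_pos
  have h1 := (F i).le_opNorm (OnePoint.continuousMapMkNat y l hyl)
  have h2 : ‖OnePoint.continuousMapMkNat y l hyl‖ ≤ 1 := by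
    rw [ContinuousMap.norm_le _ zero_le_one]
    intro x
    induction x using OnePoint.rec with
    | infty => exact hl
    | coe k => exact hy k
  have h3 : F i (OnePoint.continuousMapMkNat y l hyl) = (∑' k : ℕ, t i k * y k) - g i * l := rfl
  rw [h3, Real.norm_eq_abs] at h1
  have h4 : ‖F i‖ * ‖OnePoint.continuousMapMkNat y l hyl‖ ≤ C * 1 :=
    mul_le_mul (hC i) h2 (norm_nonneg _) ((norm_nonneg _).trans (hC i))
  linarith

/-- Matrices with null differences act on null sequences. -/
lemma toeplitz_null (T : ℕ → ℕ → ℝ) (H : ℕ → ℝ) (hT : ∀ m, Summable fun k => |T m k|)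
    (hH : Summable fun k => |H k|) (C : ℝ) (hC : ∀ m, ∑' k, |T m k| ≤ C)
    (hcol : ∀ k, Tendsto (fun m => T m k) atTop (𝓝 (H k)))
    (z : ℕ → ℝ) (hz : Tendsto z atTop (𝓝 0)) :
    Tendsto (fun m => ∑' k, T m k * z k) atTop (𝓝 (∑' k, H k * z k)) := by
  obtain ⟨B, hB⟩ : ∃ B, ∀ k, |z k| ≤ B := by
    obtain ⟨B, hB⟩ := hz.abs.bddAbove_range
    exact ⟨B, fun k => hB ⟨k, rfl⟩⟩
  set D := C + ∑' k, |H k| with hD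
  have hC0 : 0 ≤ C := (tsum_nonneg fun k => abs_nonneg _).trans (hC 0)
  have hD0 : 0 ≤ D := add_nonneg hC0 (tsum_nonneg fun k => abs_nonneg _)
  have hS : ∀ m, Summable fun k => |T m k - H k| := fun m =>
    Summable.of_nonneg_of_le (fun _ => abs_nonneg _) (fun k => abs_sub (T m k) (H k)) ((hT m).add hH)
  have hSD : ∀ m, ∑' k, |T m k - H k| ≤ D := fun m => by
    refine (Summable.tsum_le_tsum (fun k => abs_sub (T m k) (H k)) (hS m) ((hT m).add hH)).trans ?_
    rw [(hT m).tsum_add hH]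
    linarith [hC m]
  rw [Metric.tendsto_atTop]
  intro ε hε
  have hδ : 0 < ε / (2 * (D + 1)) := by positivity
  obtain ⟨N, hN⟩ := (Metric.tendsto_atTop.mp hz) _ hδ
  have hfin : Tendsto (fun m => ∑ k ∈ range N, |T m k - H k| * B) atTop (𝓝 0) := by
    have : Tendsto (fun m => ∑ k ∈ range N, |T m k - H k| * B) atTop
        (𝓝 (∑ k ∈ range N, |H k - H k| * B)) :=
      tendsto_finsetSum _ fun k _ => (((hcol k).sub_const _).abs).mul_const _
    simpa using this
  obtain ⟨M, hM⟩ := eventually_atTop.mp (hfin.eventually (gt_mem_nhds (half_pos hε)))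
  refine ⟨M, fun m hm => ?_⟩
  have s1 := summable_mul_of_bound (T m) (hT m) z B hB
  have s2 := summable_mul_of_bound H hH z B hB
  rw [Real.dist_eq, ← s1.tsum_sub s2]
  have s3 : Summable fun k => |T m k * z k - H k * z k| := (s1.sub s2).abs
  have s4 : ∀ k, |T m k * z k - H k * z k| = |T m k - H k| * |z k| := fun k => by
    rw [← sub_mul, abs_mul]
  have s5 : |∑' k, (T m k * z k - H k * z k)| ≤ ∑' k, |T m k * z k - H k * z k| := by
    have := norm_tsum_le_tsum_norm (f := fun k => T m k * z k - H k * z k) s3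
    exact this
  refine lt_of_le_of_lt s5 ?_
  rw [← s3.sum_add_tsum_nat_add N]
  have b1 : ∑ k ∈ range N, |T m k * z k - H k * z k| ≤ ∑ k ∈ range N, |T m k - H k| * B :=
    Finset.sum_le_sum fun k _ => by
      rw [s4]; exact mul_le_mul_of_nonneg_left (hB k) (abs_nonneg _)
  have b2 : ∑' k, |T m (k + N) * z (k + N) - H (k + N) * z (k + N)| ≤
      ∑' k, |T m (k + N) - H (k + N)| * (ε / (2 * (D + 1))) := by
    refine Summable.tsum_le_tsum (fun k => ?_) ((summable_nat_add_iff N).mpr s3)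
      (((summable_nat_add_iff N).mpr (hS m)).mul_right _)
    rw [s4]
    have := hN (k + N) (by omega)
    rw [Real.dist_eq, sub_zero] at this
    exact mul_le_mul_of_nonneg_left this.le (abs_nonneg _)
  rw [tsum_mul_right] at b2
  have b3 : ∑' k, |T m (k + N) - H (k + N)| ≤ D := by
    have := (hS m).sum_add_tsum_nat_add N
    have h0 : 0 ≤ ∑ k ∈ range N, |T m k - H k| := Finset.sum_nonneg fun _ _ => abs_nonneg _
    linarith [hSD m]
  have b4 : D * (ε / (2 * (D + 1))) ≤ ε / 2 := by
    rw [mul_div_assoc', div_le_div_iff₀ (by positivity) (by positivity)]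
    nlinarith
  have b5 := mul_le_mul_of_nonneg_right b3 hδ.le
  linarith [hM m hm]

lemma series_split (f : ℕ → ℝ) (k : ℕ) (L : ℝ) (h : SeriesHasSum (fun j => f (k + j)) L) :
    Tendsto (fun m => ∑ j ∈ range m, f j) atTop (𝓝 ((∑ j ∈ range k, f j) + L)) := by
  rw [← tendsto_add_atTop_iff_nat k]
  have h2 : Tendsto (fun m => (∑ j ∈ range k, f j) + ∑ j ∈ range m, f (k + j)) atTop
      (𝓝 ((∑ j ∈ range k, f j) + L)) := h.const_add _
  refine h2.congr fun m => ?_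
  rw [add_comm m k, Finset.sum_range_add]

lemma row_lemma (β : ℝ) (b H : ℕ → ℝ) (W : ℕ → ℕ → ℝ) (g : ℝ)
    (hrow : ∀ (y : ℕ → ℝ) (l : ℝ), Tendsto y atTop (𝓝 l) →
      ∃ L : ℝ, Tendsto (fun m => ∑ j ∈ range m, b j * fracDeltaSeq β y j) atTop (𝓝 L))
    (hH : ∀ k, SeriesHasSum (fun j => fracDelta β (k + j) k * b (k + j)) (H k))
    (hW : ∀ m k, k ≤ m → SeriesHasSum (fun j => fracDelta β (m + j) k * b (m + j)) (W m k))
    (hg : Tendsto (fun m => ∑ k ∈ range (m + 1), W m k) atTop (𝓝 g)) :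
    (Summable fun k => |H k|) ∧ ∀ (y : ℕ → ℝ) (l : ℝ), Tendsto y atTop (𝓝 l) →
      Tendsto (fun m => ∑ j ∈ range m, b j * fracDeltaSeq β y j) atTop
        (𝓝 ((∑' k, H k * y k) - g * l)) := by
  have hd0 : ∀ j k, j < k → fracDelta β j k = 0 := fun j k h => by
    rw [fracDelta, if_neg (not_le.mpr h)]
  set T : ℕ → ℕ → ℝ := fun m k => ∑ j ∈ range m, fracDelta β j k * b j with hTdef
  have hT0 : ∀ m k, m ≤ k → T m k = 0 := fun m k h => by
    apply Finset.sum_eq_zero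
    intro j hj
    rw [hd0 j k (lt_of_lt_of_le (Finset.mem_range.mp hj) h), zero_mul]
  have hcol : ∀ k, Tendsto (fun m => T m k) atTop (𝓝 (H k)) := fun k => by
    have h1 := series_split (fun j => fracDelta β j k * b j) k (H k) (hH k)
    have h2 : ∑ j ∈ range k, fracDelta β j k * b j = 0 := hT0 k k le_rfl
    simpa [h2] using h1
  have hTW : ∀ m k, k ≤ m → W m k = H k - T m k := fun m k h => by
    have h1 := series_split (fun j => fracDelta β j k * b j) m (W m k) (hW m k h)
    have h2 := tendsto_nhds_unique h1 (hcol k)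
    simp only [hTdef]
    linarith
  have hsupp : ∀ m (z : ℕ → ℝ), ∑' k, T m k * z k = ∑ k ∈ range m, T m k * z k := fun m z =>
    tsum_eq_sum fun k hk => by
      rw [hT0 m k (by simpa using hk), zero_mul]
  have hTsum : ∀ m, Summable fun k => |T m k| := fun m =>
    summable_of_ne_finset_zero (s := range m) fun k hk => by
      rw [hT0 m k (by simpa using hk), abs_zero]
  have hswap : ∀ (y : ℕ → ℝ) m, ∑ j ∈ range m, b j * fracDeltaSeq β y j = ∑' k, T m k * y k := by
    intro y m
    rw [hsupp]
    simp only [hTdef, Finset.sum_mul, fracDeltaSeq, Finset.mul_sum]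
    rw [Finset.sum_comm (s := range m) (t := range m)]
    apply Finset.sum_congr rfl
    intro j hj
    have hj' : j + 1 ≤ m := Finset.mem_range.mp hj
    rw [← Finset.sum_subset (Finset.range_mono hj')]
    · apply Finset.sum_congr rfl
      intro k _
      ring
    · intro k _ hk
      rw [hd0 j k (by simpa using hk)]
      ring
  obtain ⟨C, hC⟩ := unif_bound T hTsum (fun _ => 0) (by
    intro y l hy
    obtain ⟨L, hL⟩ := hrow y l hy
    obtain ⟨C, hC⟩ := hL.abs.bddAbove_range
    refine ⟨C, fun i => ?_⟩
    have := hC ⟨i, rfl⟩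
    simp only [hswap] at this
    simpa using this)
  simp only [abs_zero, add_zero] at hC
  have hHs : Summable fun k => |H k| := by
    refine summable_of_sum_range_le (c := C) (fun _ => abs_nonneg _) fun N => ?_
    refine le_of_tendsto (tendsto_finsetSum (range N) fun k _ => (hcol k).abs)
      (Eventually.of_forall fun m => ?_)
    exact ((hTsum m).sum_le_tsum _ fun _ _ => abs_nonneg _).trans (hC m)
  refine ⟨hHs, fun y l hy => ?_⟩
  have hHt : Tendsto (fun m => ∑ k ∈ range (m + 1), H k) atTop (𝓝 (∑' k, H k)) :=
    hHs.of_abs.hasSum.tendsto_sum_nat.comp (tendsto_add_atTop_nat 1)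
  have hTt : Tendsto (fun m => ∑' k, T m k) atTop (𝓝 ((∑' k, H k) - g)) := by
    refine (hHt.sub hg).congr fun m => ?_
    rw [← Finset.sum_sub_distrib, tsum_eq_sum (s := range (m + 1))]
    · apply Finset.sum_congr rfl
      intro k hk
      rw [hTW m k (Nat.lt_succ_iff.mp (Finset.mem_range.mp hk))]
      ring
    · intro k hk
      apply hT0
      have : m + 1 ≤ k := by simpa using hk
      omega
  have hz : Tendsto (fun k => y k - l) atTop (𝓝 0) := by
    simpa using hy.sub_const l
  have h1 := toeplitz_null T H hTsum hHs C hC hcol _ hz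
  have h2 := h1.add (hTt.mul_const l)
  obtain ⟨B, hB⟩ : ∃ B, ∀ k, |y k| ≤ B := by
    obtain ⟨B, hB⟩ := hy.abs.bddAbove_range
    exact ⟨B, fun k => hB ⟨k, rfl⟩⟩
  have hsplit : ∀ t : ℕ → ℝ, (Summable fun k => |t k|) →
      ∑' k, t k * (y k - l) = (∑' k, t k * y k) - (∑' k, t k) * l := fun t ht => by
    rw [← tsum_mul_right, ← (summable_mul_of_bound t ht y B hB).tsum_sub (ht.of_abs.mul_right l)]
    congr 1
    funext k
    ring
  simp only [hswap]
  simp only [hsplit _ hHs, hsplit _ (hTsum _)] at h2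
  convert h2 using 1
  · funext m; ring
  · congr 1; ring

/-- Let `A ∈ (c(Δ^(α)), c₀)`. Then `L_A` is compact iff
`lim_r sup_{n≥r} ( ∑_k |â_{nk}| + |γ_n| ) = 0`. -/
theorem compact_cDelta_into_c0 (α : ℝ) (hα : ∀ m : ℤ, α ≠ (m : ℝ))
    (a : ℕ → ℕ → ℝ)
    (hrows : ∀ x : ℕ → ℝ, memCDelta α x → ∀ n : ℕ, ∃ L : ℝ, SeriesHasSum (fun k => a n k * x k) L)
    (hmaps : ∀ x : ℕ → ℝ, memCDelta α x → Tendsto (matMul a x) atTop (nhds 0))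
    (Ahat : ℕ → ℕ → ℝ)
    (hAhat : ∀ n k, SeriesHasSum (fun j => fracDelta (-α) (k + j) k * a n (k + j)) (Ahat n k))
    (W : ℕ → ℕ → ℕ → ℝ)
    (hW : ∀ n m k, k ≤ m →
      SeriesHasSum (fun j => fracDelta (-α) (m + j) k * a n (m + j)) (W n m k))
    (γ : ℕ → ℝ)
    (hγ : ∀ n, Tendsto (fun m => ∑ k ∈ Finset.range (m + 1), W n m k) atTop (nhds (γ n))) :
    (∀ u : ℕ → (ℕ → ℝ), (∀ i, memCDelta α (u i)) → (∃ C : ℝ, ∀ i, deltaNorm α (u i) ≤ C) →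
      ∃ φ : ℕ → ℕ, StrictMono φ ∧
        ∃ y : ℕ → ℝ, Tendsto y atTop (nhds 0) ∧
          Tendsto (fun i => ⨆ n, |matMul a (u (φ i)) n - y n|) atTop (nhds 0)) ↔
    Tendsto (fun r => ⨆ n : {n : ℕ // r ≤ n}, (∑' k, |Ahat (n : ℕ) k|) + |γ (n : ℕ)|)
      atTop (nhds 0) := by
  have hα' : ∀ m : ℤ, -α ≠ (m : ℝ) := fun m hm => hα (-m) (by push_cast; linarith)
  have inv1 : ∀ x, fracDeltaSeq (-α) (fracDeltaSeq α x) = x := fracDeltaSeq_inv α hα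
  have inv2 : ∀ y, fracDeltaSeq α (fracDeltaSeq (-α) y) = y := fun y => by
    have := fracDeltaSeq_inv (-α) hα' y
    rwa [neg_neg] at this
  have hrow := fun n => row_lemma (-α) (a n) (Ahat n) (W n) (γ n) (by
    intro y l hy
    obtain ⟨L, hL⟩ := hrows (fracDeltaSeq (-α) y) ⟨l, by rw [inv2]; exact hy⟩ n
    exact ⟨L, hL⟩) (hAhat n) (hW n) (hγ n)
  have hsum : ∀ n, Summable fun k => |Ahat n k| := fun n => (hrow n).1
  have hform : ∀ (y : ℕ → ℝ) (l : ℝ), Tendsto y atTop (𝓝 l) → ∀ n,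
      matMul a (fracDeltaSeq (-α) y) n = (∑' k, Ahat n k * y k) - γ n * l := fun y l hy n =>
    ((hrow n).2 y l hy).limUnder_eq
  have hnull : ∀ (y : ℕ → ℝ) (l : ℝ), Tendsto y atTop (𝓝 l) →
      Tendsto (matMul a (fracDeltaSeq (-α) y)) atTop (𝓝 0) := fun y l hy =>
    hmaps _ ⟨l, by rw [inv2]; exact hy⟩
  set s : ℕ → ℝ := fun n => (∑' k, |Ahat n k|) + |γ n| with hs
  have hs0 : ∀ n, 0 ≤ s n := fun n =>
    add_nonneg (tsum_nonneg fun _ => abs_nonneg _) (abs_nonneg _)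
  obtain ⟨K, hK⟩ : ∃ K, ∀ n, s n ≤ K := unif_bound Ahat hsum γ (by
    intro y l hy
    obtain ⟨C, hC⟩ := (hnull y l hy).abs.bddAbove_range
    refine ⟨C, fun i => ?_⟩
    rw [← hform y l hy i]
    exact hC ⟨i, rfl⟩)
  have hiff : Tendsto (fun r => ⨆ n : {n : ℕ // r ≤ n}, (∑' k, |Ahat (n : ℕ) k|) + |γ (n : ℕ)|)
      atTop (𝓝 0) ↔ Tendsto s atTop (𝓝 0) := by
    constructor
    · intro h
      refine squeeze_zero hs0 (fun r => ?_) h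
      exact le_ciSup (f := fun n : {n : ℕ // r ≤ n} => s n)
        ⟨K, by rintro _ ⟨n, rfl⟩; exact hK n⟩ ⟨r, le_rfl⟩
    · intro h
      rw [Metric.tendsto_atTop] at h ⊢
      intro ε hε
      obtain ⟨N, hN⟩ := h (ε / 2) (half_pos hε)
      refine ⟨N, fun r hr => ?_⟩
      have h1 : (⨆ n : {n : ℕ // r ≤ n}, s n) ≤ ε / 2 := by
        haveI : Nonempty {n : ℕ // r ≤ n} := ⟨⟨r, le_rfl⟩⟩
        refine ciSup_le fun n => ?_
        have := hN n (hr.trans n.2)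
        rw [Real.dist_eq, sub_zero] at this
        exact (le_abs_self _).trans this.le
      have h2 : 0 ≤ (⨆ n : {n : ℕ // r ≤ n}, s n) := Real.iSup_nonneg fun n => hs0 n
      rw [Real.dist_eq, sub_zero]
      change |⨆ n : {n : ℕ // r ≤ n}, s n| < ε
      rw [abs_of_nonneg h2]
      linarith
  rw [hiff]
  constructor
  · intro hcomp
    choose Y l hY1 hl1 hYl hYb using fun n : ℕ =>
      exists_norming (Ahat n) (hsum n) (γ n) (1 / ((n : ℝ) + 1)) (by positivity)
    refine tendsto_of_subseq_tendsto fun ns hns => ?_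
    obtain ⟨φ, hφ, y, hy, hlim⟩ := hcomp (fun i => fracDeltaSeq (-α) (Y (ns i)))
      (fun i => ⟨l (ns i), by rw [inv2]; exact hYl _⟩)
      ⟨1, fun i => by
        rw [deltaNorm, inv2]
        exact ciSup_le fun k => hY1 _ k⟩
    refine ⟨φ, ?_⟩
    have ht : Tendsto (fun i => ns (φ i)) atTop atTop := hns.comp hφ.tendsto_atTop
    have h1 : Tendsto (fun i => |y (ns (φ i))|) atTop (𝓝 0) := by
      simpa using (hy.comp ht).abs
    have h2 : Tendsto (fun i => 1 / (((ns (φ i) : ℕ) : ℝ) + 1)) atTop (𝓝 0) :=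
      tendsto_one_div_add_atTop_nhds_zero_nat.comp ht
    have h3 := (hlim.add h1).add h2
    simp only [add_zero] at h3
    refine squeeze_zero (fun i => hs0 _) (fun i => ?_) h3
    set n := ns (φ i) with hn
    have hbdd : BddAbove (Set.range fun m => |matMul a (fracDeltaSeq (-α) (Y n)) m - y m|) :=
      ((hnull _ _ (hYl n)).sub hy).abs.bddAbove_range
    have b1 := le_ciSup hbdd n
    have b2 := hYb n
    rw [← hform (Y n) (l n) (hYl n) n] at b2
    have b3 := abs_sub_abs_le_abs_sub (matMul a (fracDeltaSeq (-α) (Y n)) n) (y n)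
    change s n ≤ _
    have b4 : s n - 1 / ((n : ℝ) + 1) ≤ |matMul a (fracDeltaSeq (-α) (Y n)) n| := b2
    linarith
  · rintro hs_lim u hu ⟨C, hC⟩
    have hbd : ∀ i n, |matMul a (u i) n| ≤ s n * C := by
      intro i n
      obtain ⟨l, hl⟩ := hu i
      have hk : ∀ k, |fracDeltaSeq α (u i) k| ≤ C := fun k =>
        (le_ciSup hl.abs.bddAbove_range k).trans (hC i)
      have hlC : |l| ≤ C := le_of_tendsto hl.abs (Eventually.of_forall hk)
      have := hform (fracDeltaSeq α (u i)) l hl n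
      rw [inv1] at this
      rw [this]
      exact tsum_le_of_bound (Ahat n) (hsum n) _ C hk _ _ hlC
    have hcpt : IsCompact (Set.pi Set.univ fun n => Set.Icc (-(s n * C)) (s n * C)) :=
      isCompact_univ_pi fun n => isCompact_Icc
    obtain ⟨y, hy, φ, hφ, hlim⟩ := hcpt.tendsto_subseq (x := fun i => matMul a (u i))
      (fun i n _ => abs_le.mp (hbd i n))
    have hyb : ∀ n, |y n| ≤ s n * C := fun n => abs_le.mpr (hy n (Set.mem_univ n))
    have hsC : Tendsto (fun n => s n * C) atTop (𝓝 0) := by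
      simpa using hs_lim.mul_const C
    refine ⟨φ, hφ, y, squeeze_zero_norm hyb hsC, ?_⟩
    rw [tendsto_pi_nhds] at hlim
    rw [Metric.tendsto_atTop]
    intro ε hε
    obtain ⟨N, hN⟩ := eventually_atTop.mp
      (hsC.eventually (gt_mem_nhds (show (0 : ℝ) < ε / 4 by positivity)))
    have hev : ∀ᶠ i in atTop, ∀ n ∈ range N, |matMul a (u (φ i)) n - y n| < ε / 2 := by
      rw [Filter.eventually_all_finset]
      intro n _
      have := ((hlim n).sub_const (y n)).abs
      simp only [sub_self, abs_zero] at this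
      exact this.eventually (gt_mem_nhds (half_pos hε))
    obtain ⟨M, hM⟩ := eventually_atTop.mp hev
    refine ⟨M, fun i hi => ?_⟩
    have h1 : (⨆ n, |matMul a (u (φ i)) n - y n|) ≤ ε / 2 := by
      refine ciSup_le fun n => ?_
      by_cases hn : n < N
      · exact (hM i hi n (Finset.mem_range.mpr hn)).le
      · have c1 := hN n (not_lt.mp hn)
        have c2 := abs_sub (matMul a (u (φ i)) n) (y n)
        have c3 := hbd (φ i) n
        have c4 := hyb n
        linarith
    rw [Real.dist_eq, sub_zero, abs_of_nonneg (Real.iSup_nonneg fun n => abs_nonneg _)]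
    linarith
end
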